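/- arXiv:2005.14334 — 5 statements merged into one kernel-verified Lean document; each statement's English description precedes it below -/
import Mathlib

section
/- Let N ≥ 10 be an integer and 0 < A < B ≤ 1. Then for every r with A ≤ r ≤ B one has ω[A,B](r) ≥ N(N−4)·B²·r^{−1} / ((N−2)² + 2(N−2)·B^N). -/
open MeasureTheory Filter Set

/-- The denominator `D = (N-2)²B^(N-4) - 4A^(N-4) + 2(N-2)Bᴺ(B^(N-4) - A^(N-4))`. -/
noncomputable def DAB (N : ℕ) (A B : ℝ) : ℝ :=
  ((N:ℝ) - 2) ^ 2 * B ^ (N - 4) - 4 * A ^ (N - 4)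
    + 2 * ((N:ℝ) - 2) * B ^ N * (B ^ (N - 4) - A ^ (N - 4))

/-- The explicit radial function `ω[A,B]` of Lemma 2.2. -/
noncomputable def omegaAB (N : ℕ) (A B : ℝ) (r : ℝ) : ℝ :=
  if r < A then
    (N : ℝ) * ((N:ℝ) - 4) * B ^ (N - 2) * A ^ (-2 : ℤ) * r / DAB N A B
  else if r ≤ B then
    ((N : ℝ) * ((N:ℝ) - 2) * B ^ (N - 2) * r ^ (-1 : ℤ)
      - 2 * (N : ℝ) * A ^ (N - 4) * B ^ (N - 2) * r ^ ((3:ℤ) - (N:ℤ))) / DAB N A B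
  else
    ((((N:ℝ) - 2) ^ 2 * B ^ (N - 4) - 4 * A ^ (N - 4)) * r
      + 2 * ((N:ℝ) - 2) * B ^ N * (B ^ (N - 4) - A ^ (N - 4)) * r ^ ((1:ℤ) - (N:ℤ)))
      / DAB N A B

theorem stmt9 (N : ℕ) (hN : 10 ≤ N) (A B : ℝ)
    (hA : 0 < A) (hAB : A < B) (hB : B ≤ 1) :
    ∀ r : ℝ, A ≤ r → r ≤ B →
      (N : ℝ) * ((N:ℝ) - 4) * B ^ 2 * r ^ (-1 : ℤ)
          / (((N:ℝ) - 2) ^ 2 + 2 * ((N:ℝ) - 2) * B ^ N) ≤ omegaAB N A B r := by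
  intro r hAr hrB
  have hr : 0 < r := hA.trans_le hAr
  have hB0 : 0 < B := hA.trans hAB
  have hN' : (10 : ℝ) ≤ N := by exact_mod_cast hN
  have hB2 : B ^ (N - 2) = B ^ (N - 4) * B ^ 2 := by
    rw [← pow_add]; congr 1; omega
  have hpow : r ^ ((3 : ℤ) - (N : ℤ)) = r⁻¹ * (r ^ (N - 4))⁻¹ := by
    rw [← zpow_natCast, ← zpow_neg, ← zpow_neg_one, ← zpow_add₀ hr.ne']
    congr 1; omega
  have hab : A ^ (N - 4) < B ^ (N - 4) := pow_lt_pow_left₀ hAB hA.le (by omega)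
  have hratio : A ^ (N - 4) * (r ^ (N - 4))⁻¹ ≤ 1 :=
    mul_inv_le_one_of_le₀ (pow_le_pow_left₀ hA.le hAr _) (by positivity)
  rw [omegaAB, if_neg hAr.not_gt, if_pos hrB, hpow, hB2, zpow_neg_one]
  unfold DAB
  have ha : 0 < A ^ (N - 4) := by positivity
  have hBN : 0 < B ^ N := by positivity
  generalize A ^ (N - 4) = a at *
  generalize B ^ (N - 4) = b at *
  generalize (r ^ (N - 4))⁻¹ = t at *
  generalize B ^ N = c at *
  have hb0 : 0 < b := ha.trans hab
  have hM : (0 : ℝ) < (N : ℝ) - 2 := by linarith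
  have hMc : 0 < 2 * ((N : ℝ) - 2) * c := by positivity
  have hD : 0 < ((N : ℝ) - 2) ^ 2 * b - 4 * a + 2 * ((N : ℝ) - 2) * c * (b - a) := by
    have h1 := mul_pos hMc (sub_pos.2 hab)
    have h2 : 4 * b ≤ ((N : ℝ) - 2) ^ 2 * b :=
      mul_le_mul_of_nonneg_right (by nlinarith) hb0.le
    linarith
  have hnum : (N : ℝ) * (N - 4) * B ^ 2 * r⁻¹ * b ≤
      N * (N - 2) * (b * B ^ 2) * r⁻¹ - 2 * N * a * (b * B ^ 2) * (r⁻¹ * t) := by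
    have hc : 0 ≤ 2 * (N : ℝ) * (b * B ^ 2) * r⁻¹ := by positivity
    nlinarith [mul_le_mul_of_nonneg_left hratio hc]
  have hP : 0 ≤ (N : ℝ) * (N - 4) * B ^ 2 * r⁻¹ := by
    have : (0 : ℝ) ≤ (N : ℝ) - 4 := by linarith
    positivity
  rw [div_le_div_iff₀ (by positivity) hD]
  calc _ ≤ (N : ℝ) * (N - 4) * B ^ 2 * r⁻¹ *
        (b * (((N : ℝ) - 2) ^ 2 + 2 * ((N : ℝ) - 2) * c)) := by
        refine mul_le_mul_of_nonneg_left ?_ hP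
        nlinarith [mul_pos hMc ha]
    _ = (N : ℝ) * (N - 4) * B ^ 2 * r⁻¹ * b *
        (((N : ℝ) - 2) ^ 2 + 2 * ((N : ℝ) - 2) * c) := by ring
    _ ≤ _ := mul_le_mul_of_nonneg_right hnum (by positivity)
end

section
/- Let N ≥ 10 be an integer and 0 < A < B ≤ 1. Then ∫₀¹ ω[A,B](r) dr ≥ N(N−4)·B²·log(B/A) / ((N−2)² + 2(N−2)·B^N). -/
open MeasureTheory Filter Set

theorem DAB_pos {N : ℕ} (hN : 10 ≤ N) {A B : ℝ} (hA : 0 < A) (hAB : A < B) :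
    0 < DAB N A B := by
  have hB : 0 < B := hA.trans hAB
  have hN' : (10 : ℝ) ≤ N := by exact_mod_cast hN
  have hpow : A ^ (N - 4) ≤ B ^ (N - 4) := pow_le_pow_left₀ hA.le hAB.le _
  have hBp : 0 < B ^ (N - 4) := by positivity
  have h1 : 0 ≤ 2 * ((N:ℝ) - 2) * B ^ N * (B ^ (N - 4) - A ^ (N - 4)) :=
    mul_nonneg (mul_nonneg (by linarith) (by positivity)) (by linarith)
  have h2 : 64 * B ^ (N - 4) ≤ ((N:ℝ) - 2) ^ 2 * B ^ (N - 4) :=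
    mul_le_mul_of_nonneg_right (by nlinarith) hBp.le
  unfold DAB
  linarith

theorem DAB_le {N : ℕ} (hN : 10 ≤ N) {A B : ℝ} (hA : 0 < A) (hAB : A < B) :
    DAB N A B ≤ (((N:ℝ) - 2) ^ 2 + 2 * ((N:ℝ) - 2) * B ^ N) * B ^ (N - 4) := by
  have hB : 0 < B := hA.trans hAB
  have hN' : (10 : ℝ) ≤ N := by exact_mod_cast hN
  have hAp : 0 < A ^ (N - 4) := by positivity
  have h1 : 0 ≤ 2 * ((N:ℝ) - 2) * B ^ N * A ^ (N - 4) :=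
    mul_nonneg (mul_nonneg (by linarith) (by positivity)) hAp.le
  unfold DAB
  linarith

theorem le_omegaAB_of_mem_Icc {N : ℕ} (hN : 10 ≤ N) {A B r : ℝ} (hA : 0 < A) (hAB : A < B)
    (hr : r ∈ Icc A B) :
    (N : ℝ) * ((N:ℝ) - 4) * B ^ (N - 2) / DAB N A B * r⁻¹ ≤ omegaAB N A B r := by
  have hr0 : 0 < r := hA.trans_le hr.1
  have hB : 0 < B := hA.trans hAB
  have hD := DAB_pos hN hA hAB
  have key : A ^ (N - 4) * r ^ ((3:ℤ) - (N:ℤ)) ≤ r⁻¹ := by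
    calc A ^ (N - 4) * r ^ ((3:ℤ) - (N:ℤ)) ≤ r ^ (N - 4) * r ^ ((3:ℤ) - (N:ℤ)) := by
          gcongr; exact hr.1
      _ = r⁻¹ := by
          rw [← zpow_natCast, ← zpow_add₀ hr0.ne', ← zpow_neg_one]
          congr 1
          omega
  rw [omegaAB, if_neg (not_lt.2 hr.1), if_pos hr.2, zpow_neg_one, div_mul_eq_mul_div]
  gcongr
  have := mul_le_mul_of_nonneg_left key (by positivity : 0 ≤ 2 * (N:ℝ) * B ^ (N - 2))
  linarith

theorem omegaAB_nonneg {N : ℕ} (hN : 10 ≤ N) {A B r : ℝ} (hA : 0 < A) (hAB : A < B)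
    (hr : 0 ≤ r) : 0 ≤ omegaAB N A B r := by
  have hB : 0 < B := hA.trans hAB
  have hN' : (10 : ℝ) ≤ N := by exact_mod_cast hN
  have hN4 : (0 : ℝ) ≤ N - 4 := by linarith
  have hN2 : (0 : ℝ) ≤ N - 2 := by linarith
  have hD := DAB_pos hN hA hAB
  rcases lt_or_ge r A with h | h
  · rw [omegaAB, if_pos h]
    positivity
  rcases le_or_gt r B with h' | h'
  · exact le_trans (by positivity) (le_omegaAB_of_mem_Icc hN hA hAB ⟨h, h'⟩)
  · have hpow : A ^ (N - 4) ≤ B ^ (N - 4) := pow_le_pow_left₀ hA.le hAB.le _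
    have hBp : 0 < B ^ (N - 4) := by positivity
    have h1 : 0 ≤ B ^ (N - 4) - A ^ (N - 4) := by linarith
    have h2 : 0 ≤ ((N:ℝ) - 2) ^ 2 * B ^ (N - 4) - 4 * A ^ (N - 4) := by
      have : 64 * B ^ (N - 4) ≤ ((N:ℝ) - 2) ^ 2 * B ^ (N - 4) :=
        mul_le_mul_of_nonneg_right (by nlinarith) hBp.le
      linarith
    rw [omegaAB, if_neg (not_lt.2 h), if_neg (not_le.2 h')]
    positivity

theorem intervalIntegrable_omegaAB_zero_left (N : ℕ) {A B : ℝ} (hA : 0 < A) :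
    IntervalIntegrable (omegaAB N A B) volume 0 A := by
  refine (intervalIntegrable_congr_uIoo (f := fun r =>
    (N : ℝ) * ((N:ℝ) - 4) * B ^ (N - 2) * A ^ (-2 : ℤ) * r / DAB N A B) ?_).1 ?_
  · intro r hr
    rw [uIoo_of_le hA.le] at hr
    simp only [omegaAB, if_pos hr.2]
  · exact Continuous.intervalIntegrable (by fun_prop) _ _

theorem intervalIntegrable_omegaAB_middle (N : ℕ) {A B : ℝ} (hA : 0 < A) (hAB : A < B) :
    IntervalIntegrable (omegaAB N A B) volume A B := by
  refine ContinuousOn.intervalIntegrable (ContinuousOn.congr (f := fun r =>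
    ((N : ℝ) * ((N:ℝ) - 2) * B ^ (N - 2) * r ^ (-1 : ℤ)
      - 2 * (N : ℝ) * A ^ (N - 4) * B ^ (N - 2) * r ^ ((3:ℤ) - (N:ℤ))) / DAB N A B) ?_ ?_)
  · intro r hr
    rw [uIcc_of_le hAB.le] at hr
    have hr0 : r ≠ 0 := (hA.trans_le hr.1).ne'
    exact ContinuousAt.continuousWithinAt (by fun_prop (disch := simp [hr0]))
  · intro r hr
    rw [uIcc_of_le hAB.le] at hr
    simp only [omegaAB, if_neg (not_lt.2 hr.1), if_pos hr.2]

theorem intervalIntegrable_omegaAB_right (N : ℕ) {A B : ℝ} (hA : 0 < A) (hAB : A < B)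
    (hB : B ≤ 1) : IntervalIntegrable (omegaAB N A B) volume B 1 := by
  refine (intervalIntegrable_congr_uIoo (f := fun r =>
    ((((N:ℝ) - 2) ^ 2 * B ^ (N - 4) - 4 * A ^ (N - 4)) * r
      + 2 * ((N:ℝ) - 2) * B ^ N * (B ^ (N - 4) - A ^ (N - 4)) * r ^ ((1:ℤ) - (N:ℤ)))
      / DAB N A B) ?_).1 ?_
  · intro r hr
    rw [uIoo_of_le hB] at hr
    simp only [omegaAB, if_neg (not_lt.2 (hAB.trans hr.1).le), if_neg (not_le.2 hr.1)]
  · refine ContinuousOn.intervalIntegrable fun r hr => ?_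
    rw [uIcc_of_le hB] at hr
    have hr0 : r ≠ 0 := ((hA.trans hAB).trans_le hr.1).ne'
    exact ContinuousAt.continuousWithinAt (by fun_prop (disch := simp [hr0]))

theorem stmt10 (N : ℕ) (hN : 10 ≤ N) (A B : ℝ)
    (hA : 0 < A) (hAB : A < B) (hB : B ≤ 1) :
    (N : ℝ) * ((N:ℝ) - 4) * B ^ 2 * Real.log (B / A)
        / (((N:ℝ) - 2) ^ 2 + 2 * ((N:ℝ) - 2) * B ^ N) ≤
      ∫ r in (0:ℝ)..1, omegaAB N A B r := by
  have hB0 : 0 < B := hA.trans hAB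
  have hN' : (10 : ℝ) ≤ N := by exact_mod_cast hN
  have hN4 : (0 : ℝ) ≤ N - 4 := by linarith
  have hD := DAB_pos hN hA hAB
  have hlog : 0 ≤ Real.log (B / A) := Real.log_nonneg ((one_le_div hA).2 hAB.le)
  have i1 := intervalIntegrable_omegaAB_zero_left N (B := B) hA
  have i2 := intervalIntegrable_omegaAB_middle N hA hAB
  have i3 := intervalIntegrable_omegaAB_right N hA hAB hB
  rw [← intervalIntegral.integral_add_adjacent_intervals (i1.trans i2) i3,
    ← intervalIntegral.integral_add_adjacent_intervals i1 i2]
  have n1 : 0 ≤ ∫ r in (0:ℝ)..A, omegaAB N A B r :=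
    intervalIntegral.integral_nonneg hA.le fun r hr => omegaAB_nonneg hN hA hAB hr.1
  have n3 : 0 ≤ ∫ r in B..1, omegaAB N A B r :=
    intervalIntegral.integral_nonneg hB fun r hr =>
      omegaAB_nonneg hN hA hAB (hB0.le.trans hr.1)
  have n2 : (N : ℝ) * ((N:ℝ) - 4) * B ^ (N - 2) / DAB N A B * Real.log (B / A) ≤
      ∫ r in A..B, omegaAB N A B r := by
    rw [← integral_inv_of_pos hA hB0, ← intervalIntegral.integral_const_mul]
    refine intervalIntegral.integral_mono_on hAB.le ?_ i2 fun r hr =>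
      le_omegaAB_of_mem_Icc hN hA hAB hr
    refine (intervalIntegral.intervalIntegrable_inv (fun r hr => ?_) continuousOn_id).const_mul _
    rw [uIcc_of_le hAB.le] at hr
    exact (hA.trans_le hr.1).ne'
  have hsplit : B ^ (N - 2) = B ^ 2 * B ^ (N - 4) := by
    rw [← pow_add]
    congr 1
    omega
  have hE : 0 < ((N:ℝ) - 2) ^ 2 + 2 * ((N:ℝ) - 2) * B ^ N := by
    have : (0 : ℝ) < N - 2 := by linarith
    positivity
  have n0 : (N : ℝ) * ((N:ℝ) - 4) * B ^ 2 * Real.log (B / A)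
        / (((N:ℝ) - 2) ^ 2 + 2 * ((N:ℝ) - 2) * B ^ N) ≤
      (N : ℝ) * ((N:ℝ) - 4) * B ^ (N - 2) / DAB N A B * Real.log (B / A) := by
    rw [div_mul_eq_mul_div, div_le_div_iff₀ hE hD, hsplit]
    have := mul_le_mul_of_nonneg_left (DAB_le hN hA hAB)
      (by positivity : 0 ≤ (N : ℝ) * ((N:ℝ) - 4) * B ^ 2 * Real.log (B / A))
    linarith
  linarith
end

section
/- Let N ≥ 10 be an integer and let φ : (0,1) → (0,∞) satisfy lim_{r→0⁺} φ(r) = +∞. Then there exists a C^∞ function Ψ : (0,1] → ℝ such that: (i) 0 < Ψ(r) ≤ 2(N−2)/r² and Ψ'(r) < 0 for every r ∈ (0,1]; (ii) liminf_{r→0⁺} Ψ(r)/φ(r) = 0 and limsup_{r→0⁺} r²·Ψ(r) = 2(N−2) (in particular Ψ is unbounded); and (iii) every radial solution ω of the linear problem (P_Ψ) satisfies ∫₀¹ ω(r) dr = +∞. -/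
open MeasureTheory Filter Set

/-- `Ψ` satisfies the radial stability inequality in dimension `N`. -/
def RadialStability (N : ℕ) (Ψ : ℝ → ℝ) : Prop :=
  ∀ ξ : ℝ → ℝ, (∃ K : NNReal, LipschitzOnWith K ξ (Set.Icc 0 1)) → ξ 1 = 0 →
    (∫ r in (0:ℝ)..1, r ^ (N - 1) * Ψ r * ξ r ^ 2) ≤
      ∫ r in (0:ℝ)..1, r ^ (N - 1) * (deriv ξ r) ^ 2

/-- `ω`, with derivative `ω'` on `(0,1]`, is a radial solution of the linear
problem `(P_Ψ)`: it is `C¹` on `(0,1]`, `ω 1 = 1`,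
`∫₀¹ r^(N-1) (ω² + ω'²) < ∞`, and the weak formulation of
`Δω + (Ψ - (N-1)/r²) ω = 0` holds against all Lipschitz test functions
vanishing at `1`. -/
def IsRadialSolution (N : ℕ) (Ψ ω ω' : ℝ → ℝ) : Prop :=
  (∀ r ∈ Set.Ioc (0:ℝ) 1, HasDerivWithinAt ω (ω' r) (Set.Ioc 0 1) r) ∧
  ContinuousOn ω' (Set.Ioc 0 1) ∧
  ω 1 = 1 ∧
  IntervalIntegrable (fun r => r ^ (N - 1) * (ω r ^ 2 + ω' r ^ 2)) volume 0 1 ∧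
  ∀ v : ℝ → ℝ, (∃ K : NNReal, LipschitzOnWith K v (Set.Icc 0 1)) → v 1 = 0 →
    (∫ r in (0:ℝ)..1, r ^ (N - 1) * ω' r * deriv v r) =
      ∫ r in (0:ℝ)..1, r ^ (N - 1) * (Ψ r - ((N:ℝ) - 1) / r ^ 2) * ω r * v r

/-- Fundamental lemma of the calculus of variations (du Bois-Reymond form). -/
theorem hasDerivAt_of_forall_integral_mul_eq {W K : ℝ → ℝ} {a b : ℝ} (hab : a < b)
    (hW : Continuous W) (hK : Continuous K)
    (h : ∀ g : ℝ → ℝ, Continuous g → (∫ r in a..b, g r) = 0 →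
      (∫ r in a..b, W r * g r) = -∫ r in a..b, K r * ∫ s in a..r, g s) :
    ∀ r ∈ Ioo a b, HasDerivAt W (K r) r := by
  set F : ℝ → ℝ := fun r => ∫ s in a..r, K s with hF
  have hFd : ∀ r, HasDerivAt F (K r) r := fun r =>
    intervalIntegral.integral_hasDerivAt_right (hK.intervalIntegrable _ _)
      hK.aestronglyMeasurable.stronglyMeasurableAtFilter hK.continuousAt
  have hFc : Continuous F := continuous_iff_continuousAt.2 fun r => (hFd r).continuousAt
  set m : ℝ := (b - a)⁻¹ * ∫ r in a..b, (W r - F r) with hm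
  set g : ℝ → ℝ := fun r => W r - F r - m with hg
  have hgc : Continuous g := (hW.sub hFc).sub continuous_const
  have hba : b - a ≠ 0 := (sub_pos.2 hab).ne'
  have hg0 : (∫ r in a..b, g r) = 0 := by
    have : (∫ r in a..b, g r) = (∫ r in a..b, (W r - F r)) - ∫ _ in a..b, m :=
      intervalIntegral.integral_sub ((hW.sub hFc).intervalIntegrable _ _)
        (continuous_const.intervalIntegrable _ _)
    rw [this, intervalIntegral.integral_const, hm, smul_eq_mul, mul_inv_cancel_left₀ hba, sub_self]
  set v : ℝ → ℝ := fun r => ∫ s in a..r, g s with hv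
  have hvd : ∀ r, HasDerivAt v (g r) r := fun r =>
    intervalIntegral.integral_hasDerivAt_right (hgc.intervalIntegrable _ _)
      hgc.aestronglyMeasurable.stronglyMeasurableAtFilter hgc.continuousAt
  have hparts := intervalIntegral.integral_mul_deriv_eq_deriv_mul (a := a) (b := b)
    (fun x _ => hFd x) (fun x _ => hvd x) (hK.intervalIntegrable _ _) (hgc.intervalIntegrable _ _)
  have hva : v a = 0 := by simp [hv]
  have hvb : v b = 0 := hg0
  have hWg := h g hgc hg0
  have hsq : (∫ r in a..b, g r ^ 2) = 0 := by
    have e1 : (∫ r in a..b, (W r * g r - F r * g r - m * g r)) =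
        (∫ r in a..b, (W r * g r - F r * g r)) - ∫ r in a..b, m * g r :=
      intervalIntegral.integral_sub (((hW.mul hgc).sub (hFc.mul hgc)).intervalIntegrable _ _)
        ((continuous_const.mul hgc).intervalIntegrable _ _)
    have e2 : (∫ r in a..b, (W r * g r - F r * g r)) =
        (∫ r in a..b, W r * g r) - ∫ r in a..b, F r * g r :=
      intervalIntegral.integral_sub ((hW.mul hgc).intervalIntegrable _ _)
        ((hFc.mul hgc).intervalIntegrable _ _)
    have e3 : (∫ r in a..b, g r ^ 2) = ∫ r in a..b, (W r * g r - F r * g r - m * g r) :=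
      intervalIntegral.integral_congr fun r _ => by simp only [hg]; ring
    rw [e3, e1, e2, intervalIntegral.integral_const_mul, hg0, hWg, hparts, hva, hvb]
    simp only [hv]
    ring
  have hae := (intervalIntegral.integral_eq_zero_iff_of_le_of_nonneg_ae hab.le
    (Eventually.of_forall fun r => sq_nonneg (g r)) ((hgc.pow 2).intervalIntegrable _ _)).1 hsq
  have hz := Measure.eqOn_Ioc_of_ae_eq volume hae (hgc.pow 2).continuousOn
    continuousOn_const
  intro r hr
  refine ((hFd r).add_const m).congr_of_eventuallyEq ?_
  filter_upwards [Ioo_mem_nhds hr.1 hr.2] with s hs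
  have h0 : g s = 0 := by simpa using hz ⟨hs.1, hs.2.le⟩
  simp only [hg] at h0
  linarith

/-- Weak equations on `(0,1)` tested against Lipschitz functions hold classically. -/
theorem hasDerivAt_of_weak {W K : ℝ → ℝ} (hW : ContinuousOn W (Ioo 0 1))
    (hK : ContinuousOn K (Ioo 0 1))
    (h : ∀ v : ℝ → ℝ, (∃ C : NNReal, LipschitzOnWith C v (Icc 0 1)) → v 1 = 0 →
      (∫ r in (0:ℝ)..1, W r * deriv v r) = -∫ r in (0:ℝ)..1, K r * v r) :
    ∀ r ∈ Ioo (0:ℝ) 1, HasDerivAt W (K r) r := by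
  intro r hr
  obtain ⟨a, ha0, har⟩ := exists_between hr.1
  obtain ⟨b, hrb, hb1⟩ := exists_between hr.2
  have hab : a < b := har.trans hrb
  have hsub : Icc a b ⊆ Ioo (0:ℝ) 1 := fun x hx => ⟨ha0.trans_le hx.1, hx.2.trans_lt hb1⟩
  have ext : ∀ f : ℝ → ℝ, ContinuousOn f (Ioo 0 1) → ∃ f' : ℝ → ℝ, Continuous f' ∧
      EqOn f' f (Icc a b) := fun f hf =>
    ⟨IccExtend hab.le ((Icc a b).domRestrict f),
      (continuousOn_iff_continuous_domRestrict.1 (hf.mono hsub)).Icc_extend',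
      fun x hx => by rw [IccExtend_of_mem _ _ hx]; rfl⟩
  obtain ⟨W', hW'c, hW'⟩ := ext W hW
  obtain ⟨K', hK'c, hK'⟩ := ext K hK
  have key : ∀ g : ℝ → ℝ, Continuous g → (∫ r in a..b, g r) = 0 →
      (∫ r in a..b, W' r * g r) = -∫ r in a..b, K' r * ∫ s in a..r, g s := by
    intro g hg hg0
    set u : ℝ → ℝ := fun r => ∫ s in a..r, g s with hu
    have hud : ∀ r, HasDerivAt u (g r) r := fun r =>
      intervalIntegral.integral_hasDerivAt_right (hg.intervalIntegrable _ _)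
        hg.aestronglyMeasurable.stronglyMeasurableAtFilter hg.continuousAt
    have hua : u a = 0 := by simp [hu]
    have hub : u b = 0 := hg0
    set v : ℝ → ℝ := fun r => u (projIcc a b hab.le r) with hv
    have hvl : ∀ x ≤ a, v x = 0 := fun x hx => by
      simp only [hv, projIcc_of_le_left hab.le hx, hua]
    have hvr : ∀ x, b ≤ x → v x = 0 := fun x hx => by
      simp only [hv, projIcc_of_right_le hab.le hx, hub]
    have hvm : ∀ x ∈ Icc a b, v x = u x := fun x hx => by
      simp only [hv, projIcc_of_mem hab.le hx]
    have hdl : ∀ x < a, deriv v x = 0 := fun x hx => by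
      have : v =ᶠ[nhds x] fun _ => 0 := by
        filter_upwards [Iio_mem_nhds hx] with y hy using hvl y (le_of_lt hy)
      rw [this.deriv_eq, deriv_const]
    have hdr : ∀ x, b < x → deriv v x = 0 := fun x hx => by
      have : v =ᶠ[nhds x] fun _ => 0 := by
        filter_upwards [Ioi_mem_nhds hx] with y hy using hvr y (le_of_lt hy)
      rw [this.deriv_eq, deriv_const]
    have hdm : ∀ x ∈ Ioo a b, deriv v x = g x := fun x hx => by
      have : v =ᶠ[nhds x] u := by
        filter_upwards [Ioo_mem_nhds hx.1 hx.2] with y hy using hvm y (Ioo_subset_Icc_self hy)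
      rw [this.deriv_eq, (hud x).deriv]
    have hlip : ∃ C : NNReal, LipschitzOnWith C v (Icc 0 1) := by
      obtain ⟨C, hC⟩ := isCompact_Icc.exists_bound_of_continuousOn (s := Icc a b) hg.continuousOn
      have hC0 : 0 ≤ C := (norm_nonneg _).trans (hC a ⟨le_rfl, hab.le⟩)
      have h1 : LipschitzOnWith ⟨C, hC0⟩ u (Icc a b) :=
        (convex_Icc a b).lipschitzOnWith_of_nnnorm_hasDerivWithin_le
          (fun x _ => (hud x).hasDerivWithinAt) (fun x hx => hC x hx)
      refine ⟨⟨C, hC0⟩, LipschitzWith.lipschitzOnWith (LipschitzWith.of_dist_le_mul fun x y => ?_)⟩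
      refine (h1.dist_le_mul _ (projIcc a b hab.le x).2 _ (projIcc a b hab.le y).2).trans ?_
      refine mul_le_mul_of_nonneg_left ?_ hC0
      have := (LipschitzWith.projIcc hab.le).dist_le_mul x y
      simpa [Subtype.dist_eq] using this
    have hweak := h v hlip (hvr 1 hb1.le)
    have hIoc : Ioc a b ⊆ Ioc (0:ℝ) 1 := Ioc_subset_Ioc ha0.le hb1.le
    have hnull : ∀ᵐ x : ℝ, x ≠ a ∧ x ≠ b := by
      have h1 : ∀ᵐ x : ℝ, x ≠ a := by simp [ae_iff, measure_singleton]
      have h2 : ∀ᵐ x : ℝ, x ≠ b := by simp [ae_iff, measure_singleton]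
      exact h1.and h2
    have e1 : (∫ r in (0:ℝ)..1, W r * deriv v r) = ∫ r in a..b, W' r * g r := by
      rw [intervalIntegral.integral_of_le zero_le_one, intervalIntegral.integral_of_le hab.le,
        setIntegral_eq_of_subset_of_ae_sdiff_eq_zero measurableSet_Ioc.nullMeasurableSet hIoc]
      · refine setIntegral_congr_ae measurableSet_Ioc ?_
        filter_upwards [hnull] with x hx hxm
        rw [hW' (Ioc_subset_Icc_self hxm), hdm x ⟨hxm.1, lt_of_le_of_ne hxm.2 hx.2⟩]
      · filter_upwards [hnull] with x hx hxm
        rcases lt_or_ge a x with hax | hax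
        · have : b < x := not_le.1 fun hle => hxm.2 ⟨hax, hle⟩
          rw [hdr x this, mul_zero]
        · rw [hdl x (lt_of_le_of_ne hax hx.1), mul_zero]
    have e2 : (∫ r in (0:ℝ)..1, K r * v r) = ∫ r in a..b, K' r * u r := by
      rw [intervalIntegral.integral_of_le zero_le_one, intervalIntegral.integral_of_le hab.le,
        setIntegral_eq_of_subset_of_forall_sdiff_eq_zero measurableSet_Ioc hIoc]
      · refine setIntegral_congr_fun measurableSet_Ioc fun x hx => ?_
        rw [hK' (Ioc_subset_Icc_self hx), hvm x (Ioc_subset_Icc_self hx)]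
      · intro x hxm
        rcases lt_or_ge a x with hax | hax
        · have : b < x := not_le.1 fun hle => hxm.2 ⟨hax, hle⟩
          rw [hvr x this.le, mul_zero]
        · rw [hvl x hax, mul_zero]
    rw [← e1, hweak, e2]
  have hfin := hasDerivAt_of_forall_integral_mul_eq hab hW'c hK'c key r ⟨har, hrb⟩
  rw [hK' ⟨har.le, hrb.le⟩] at hfin
  refine hfin.congr_of_eventuallyEq ?_
  filter_upwards [Ioo_mem_nhds har hrb] with s hs
  exact (hW' ⟨hs.1.le, hs.2.le⟩).symm

theorem exists_mul_lt_of_intervalIntegrable {f : ℝ → ℝ} (hf : IntervalIntegrable f volume 0 1)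
    {ρ ε : ℝ} (hρ : 0 < ρ) (hρ1 : ρ ≤ 1) (hε : 0 < ε) : ∃ r ∈ Ioc 0 ρ, r * f r < ε := by
  by_contra! h
  have h1 : IntervalIntegrable f volume 0 ρ :=
    hf.mono_set (by rw [uIcc_of_le hρ.le, uIcc_of_le zero_le_one]; exact Icc_subset_Icc_right hρ1)
  have h2 : IntervalIntegrable (fun x : ℝ => x⁻¹) volume 0 ρ := by
    refine (h1.const_mul ε⁻¹).mono_fun' measurable_inv.aestronglyMeasurable ?_
    rw [uIoc_of_le hρ.le]
    filter_upwards [ae_restrict_mem measurableSet_Ioc] with x hx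
    have hx0 := hx.1
    rw [Real.norm_of_nonneg (inv_nonneg.2 hx0.le), inv_mul_eq_div, le_div_iff₀ hε,
      inv_mul_le_iff₀ hx0]
    exact h x hx
  rw [intervalIntegrable_inv_iff] at h2
  rcases h2 with h2 | h2
  · exact hρ.ne h2
  · exact h2 left_mem_uIcc

/-- A classical solution on `(0,1)` of the radial equation in dimension `n + 10`, which is small
along a sequence tending to `0`. -/
structure IsRegularSolution (n : ℕ) (Ψ ω ω' : ℝ → ℝ) : Prop where
  continuousOn : ContinuousOn ω (Ioc 0 1)
  apply_one : ω 1 = 1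
  hasDerivAt : ∀ r ∈ Ioo (0:ℝ) 1, HasDerivAt ω (ω' r) r
  hasDerivAt' : ∀ r ∈ Ioo (0:ℝ) 1,
    HasDerivAt ω' (((n + 9) / r ^ 2 - Ψ r) * ω r - (n + 9) * ω' r / r) r
  small : ∀ ρ ∈ Ioo (0:ℝ) 1, ∀ ε > 0, ∃ r ∈ Ioc 0 ρ, r ^ (n + 10) * (ω r ^ 2 + ω' r ^ 2) < ε

namespace IsRegularSolution

variable {n : ℕ} {Ψ ω ω' : ℝ → ℝ}

theorem mul_nonneg (h : IsRegularSolution n Ψ ω ω')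
    (hΨ : ∀ r ∈ Ioo (0:ℝ) 1, r ^ 2 * Ψ r ≤ 2 * (n + 8)) {r : ℝ} (hr : r ∈ Ioo (0:ℝ) 1) :
    0 ≤ ω r * (ω r + r * ω' r) := by
  by_contra! hneg
  set V : ℝ → ℝ := fun s => s ^ (n + 7) * (ω s + s * ω' s) with hV
  have hVd : ∀ s ∈ Ioo (0:ℝ) 1,
      HasDerivAt V (s ^ (n + 6) * ω s * (2 * (n + 8) - s ^ 2 * Ψ s)) s := fun s hs => by
    have hs0 : s ≠ 0 := hs.1.ne'
    refine ((hasDerivAt_pow (n + 7) s).mul ((h.hasDerivAt s hs).add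
      ((hasDerivAt_id s).mul (h.hasDerivAt' s hs)))).congr_deriv ?_
    simp only [Pi.add_apply, Pi.mul_apply, id]
    rw [show n + 7 - 1 = n + 6 from rfl]
    push_cast
    field_simp
    ring
  set E : ℝ → ℝ := fun s => s * ω s * V s with hE
  have hEd : ∀ s ∈ Ioo (0:ℝ) 1, HasDerivAt E
      (s ^ (n + 7) * ((ω s + s * ω' s) ^ 2 + ω s ^ 2 * (2 * (n + 8) - s ^ 2 * Ψ s))) s :=
    fun s hs => by
    refine (((hasDerivAt_id s).mul (h.hasDerivAt s hs)).mul (hVd s hs)).congr_deriv ?_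
    simp only [hV, Pi.mul_apply, id]
    ring
  have hEmono : MonotoneOn E (Ioo 0 1) := by
    refine monotoneOn_of_hasDerivWithinAt_nonneg (convex_Ioo 0 1)
      (fun s hs => (hEd s hs).continuousAt.continuousWithinAt)
      (fun s hs => (hEd s (interior_subset hs)).hasDerivWithinAt) fun s hs => ?_
    have hs' := interior_subset hs
    have := hΨ s hs'
    have h0 := hs'.1
    have : 0 ≤ 2 * ((n:ℝ) + 8) - s ^ 2 * Ψ s := by linarith
    positivity
  have hEr : E r < 0 := by
    have h0 := hr.1
    have : E r = r ^ (n + 8) * (ω r * (ω r + r * ω' r)) := by simp only [hE, hV]; ring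
    rw [this]
    exact mul_neg_of_pos_of_neg (by positivity) hneg
  have hsub : Ioc 0 r ⊆ Ioo (0:ℝ) 1 := fun s hs => ⟨hs.1, hs.2.trans_lt hr.2⟩
  have hanti : AntitoneOn (fun s => V s ^ 2) (Ioc 0 r) := by
    refine antitoneOn_of_hasDerivWithinAt_nonpos (convex_Ioc 0 r)
      (fun s hs => ((hVd s (hsub hs)).pow 2).continuousAt.continuousWithinAt)
      (fun s hs => ((hVd s (hsub (interior_subset hs))).pow 2).hasDerivWithinAt) fun s hs => ?_
    have hs' := hsub (interior_subset hs)
    have h0 := hs'.1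
    have hEs : E s ≤ 0 := (hEmono hs' hr (interior_subset hs).2).trans hEr.le
    have hV0 : ω s * V s ≤ 0 := by
      have : s * (ω s * V s) ≤ 0 := by simpa only [hE, mul_assoc] using hEs
      exact nonpos_of_mul_nonpos_right this h0
    have := hΨ s hs'
    have h1 : 0 ≤ 2 * s ^ (n + 6) * (2 * ((n:ℝ) + 8) - s ^ 2 * Ψ s) := by
      have : 0 ≤ 2 * ((n:ℝ) + 8) - s ^ 2 * Ψ s := by linarith
      positivity
    have := mul_nonpos_of_nonneg_of_nonpos h1 hV0
    norm_num
    linarith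
  have hVr : 0 < V r ^ 2 := by
    have : V r ≠ 0 := fun h0 => by simp [hE, h0] at hEr
    positivity
  obtain ⟨s, hs, hlt⟩ := h.small r hr (V r ^ 2 / 2) (by positivity)
  have h1 : V r ^ 2 ≤ V s ^ 2 := hanti hs ⟨hr.1, le_rfl⟩ hs.2
  have hs1 := (hsub hs).2.le
  have hs0 := (hsub hs).1.le
  have h2 : V s ^ 2 ≤ 2 * (s ^ (n + 10) * (ω s ^ 2 + ω' s ^ 2)) := by
    have e : V s ^ 2 = s ^ (n + 10) * (s ^ (n + 4) * (ω s + s * ω' s) ^ 2) := by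
      simp only [hV]; ring
    rw [e, mul_left_comm 2]
    refine mul_le_mul_of_nonneg_left ?_ (by positivity)
    have hp : s ^ (n + 4) ≤ 1 := pow_le_one₀ hs0 hs1
    have hq : (ω s + s * ω' s) ^ 2 ≤ 2 * (ω s ^ 2 + ω' s ^ 2) := by
      have : (s * ω' s) ^ 2 ≤ ω' s ^ 2 := by
        rw [mul_pow]
        exact mul_le_of_le_one_left (sq_nonneg _) (pow_le_one₀ hs0 hs1)
      nlinarith [sq_nonneg (ω s - s * ω' s)]
    exact (mul_le_of_le_one_left (sq_nonneg _) hp).trans hq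
  linarith

theorem nonneg (h : IsRegularSolution n Ψ ω ω')
    (hΨ : ∀ r ∈ Ioo (0:ℝ) 1, r ^ 2 * Ψ r ≤ 2 * (n + 8)) {r : ℝ} (hr : r ∈ Ioc (0:ℝ) 1) :
    0 ≤ ω r := by
  have hmono : MonotoneOn (fun s => (s * ω s) ^ 2) (Ioc 0 1) := by
    refine monotoneOn_of_hasDerivWithinAt_nonneg (convex_Ioc 0 1)
      (f' := fun s => 2 * s * (ω s * (ω s + s * ω' s)))
      ((continuousOn_id.mul h.continuousOn).pow 2) (fun s hs => ?_) fun s hs => ?_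
    · rw [interior_Ioc] at hs
      refine ((((hasDerivAt_id s).mul (h.hasDerivAt s hs)).pow 2).congr_deriv ?_).hasDerivWithinAt
      simp only [Pi.mul_apply, id]
      ring
    · rw [interior_Ioc] at hs
      have := h.mul_nonneg hΨ hs
      have := hs.1
      positivity
  by_contra! hneg
  have hsub : Icc r 1 ⊆ Ioc (0:ℝ) 1 := fun s hs => ⟨hr.1.trans_le hs.1, hs.2⟩
  obtain ⟨s, hs, hs0⟩ := intermediate_value_Icc hr.2 (h.continuousOn.mono hsub)
    (⟨hneg.le, by rw [h.apply_one]; exact zero_le_one⟩ : (0:ℝ) ∈ Icc (ω r) (ω 1))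
  have hle : (r * ω r) ^ 2 ≤ (s * ω s) ^ 2 := hmono hr (hsub hs) hs.1
  rw [hs0, mul_zero, zero_pow two_ne_zero] at hle
  have : 0 < (r * ω r) ^ 2 := by
    have := (mul_neg_of_pos_of_neg hr.1 hneg).ne
    positivity
  linarith

theorem mul_deriv_le (h : IsRegularSolution n Ψ ω ω') (hΨ0 : ∀ r ∈ Ioo (0:ℝ) 1, 0 ≤ Ψ r)
    (hΨ : ∀ r ∈ Ioo (0:ℝ) 1, r ^ 2 * Ψ r ≤ 2 * (n + 8)) {r : ℝ} (hr : r ∈ Ioo (0:ℝ) 1) :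
    r * ω' r ≤ ω r := by
  by_contra! hlt
  set U : ℝ → ℝ := fun s => s ^ (n + 9) * (s * ω' s - ω s) with hU
  have hUd : ∀ s ∈ Ioo (0:ℝ) 1, HasDerivAt U (-(s ^ (n + 10) * Ψ s * ω s)) s := fun s hs => by
    have hs0 : s ≠ 0 := hs.1.ne'
    refine ((hasDerivAt_pow (n + 9) s).mul (((hasDerivAt_id s).mul (h.hasDerivAt' s hs)).sub
      (h.hasDerivAt s hs))).congr_deriv ?_
    simp only [Pi.sub_apply, Pi.mul_apply, id]
    rw [show n + 9 - 1 = n + 8 from rfl]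
    push_cast
    field_simp
    ring
  have hUanti : AntitoneOn U (Ioo 0 1) := by
    refine antitoneOn_of_hasDerivWithinAt_nonpos (convex_Ioo 0 1)
      (fun s hs => (hUd s hs).continuousAt.continuousWithinAt)
      (fun s hs => (hUd s (interior_subset hs)).hasDerivWithinAt) fun s hs => ?_
    have hs' := interior_subset hs
    have := hΨ0 s hs'
    have := hs'.1
    have := h.nonneg hΨ (Ioo_subset_Ioc_self hs')
    rw [neg_nonpos]
    positivity
  have hUr : 0 < U r := mul_pos (pow_pos hr.1 _) (sub_pos.2 hlt)
  obtain ⟨s, hs, hsm⟩ := h.small r hr (U r ^ 2 / 2) (by positivity)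
  have hs' : s ∈ Ioo (0:ℝ) 1 := ⟨hs.1, hs.2.trans_lt hr.2⟩
  have h1 : U r ^ 2 ≤ U s ^ 2 := pow_le_pow_left₀ hUr.le (hUanti hs' hr hs.2) 2
  have hs1 := hs'.2.le
  have hs0 := hs'.1.le
  have h2 : U s ^ 2 ≤ 2 * (s ^ (n + 10) * (ω s ^ 2 + ω' s ^ 2)) := by
    have e : U s ^ 2 = s ^ (n + 10) * (s ^ (n + 8) * (s * ω' s - ω s) ^ 2) := by
      simp only [hU]; ring
    rw [e, mul_left_comm 2]
    refine mul_le_mul_of_nonneg_left ?_ (by positivity)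
    have hp : s ^ (n + 8) ≤ 1 := pow_le_one₀ hs0 hs1
    have hq : (s * ω' s - ω s) ^ 2 ≤ 2 * (ω s ^ 2 + ω' s ^ 2) := by
      have : (s * ω' s) ^ 2 ≤ ω' s ^ 2 := by
        rw [mul_pow]
        exact mul_le_of_le_one_left (sq_nonneg _) (pow_le_one₀ hs0 hs1)
      nlinarith [sq_nonneg (ω s + s * ω' s)]
    exact (mul_le_of_le_one_left (sq_nonneg _) hp).trans hq
  linarith

theorem le_apply (h : IsRegularSolution n Ψ ω ω') (hΨ0 : ∀ r ∈ Ioo (0:ℝ) 1, 0 ≤ Ψ r)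
    (hΨ : ∀ r ∈ Ioo (0:ℝ) 1, r ^ 2 * Ψ r ≤ 2 * (n + 8)) {r : ℝ} (hr : r ∈ Ioc (0:ℝ) 1) :
    r ≤ ω r := by
  have hanti : AntitoneOn (fun s => ω s / s) (Ioc 0 1) := by
    refine antitoneOn_of_hasDerivWithinAt_nonpos (convex_Ioc 0 1)
      (f' := fun s => (ω' s * s - ω s * 1) / s ^ 2)
      (h.continuousOn.div continuousOn_id fun s hs => hs.1.ne') (fun s hs => ?_) fun s hs => ?_
    · rw [interior_Ioc] at hs
      exact ((h.hasDerivAt s hs).div (hasDerivAt_id s) hs.1.ne').hasDerivWithinAt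
    · rw [interior_Ioc] at hs
      have := h.mul_deriv_le hΨ0 hΨ hs
      exact div_nonpos_of_nonpos_of_nonneg (by linarith) (sq_nonneg s)
  have := hanti hr (right_mem_Ioc.2 zero_lt_one) hr.2
  simp only [h.apply_one, div_one] at this
  rwa [le_div_iff₀ hr.1, one_mul] at this

/-- Where `Ψ` differs from the critical potential by a constant, `r ω(r)` does not decay. -/
theorem le_mul_apply (h : IsRegularSolution n Ψ ω ω') (hΨ0 : ∀ r ∈ Ioo (0:ℝ) 1, 0 ≤ Ψ r)
    (hΨ : ∀ r ∈ Ioo (0:ℝ) 1, r ^ 2 * Ψ r ≤ 2 * (n + 8)) {a b G : ℝ} (ha : 0 < a) (hb : b < 1)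
    (hG0 : 0 ≤ G) (hG : G * b ^ 2 ≤ 2 * (n + 8))
    (hab : ∀ r ∈ Icc a b, Ψ r = 2 * (n + 8) / r ^ 2 - G) {r : ℝ} (hr : r ∈ Icc a b) :
    Real.exp (-2) * b ^ 2 ≤ r * ω r := by
  have hsub : Icc a b ⊆ Ioo (0:ℝ) 1 := fun s hs => ⟨ha.trans_le hs.1, hs.2.trans_lt hb⟩
  have hpos : ∀ s ∈ Icc a b, 0 < ω s := fun s hs =>
    (hsub hs).1.trans_le (h.le_apply hΨ0 hΨ (Ioo_subset_Ioc_self (hsub hs)))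
  set H : ℝ → ℝ := fun s => s * ω' s / ω s + (n + 6) * Real.log (s * ω s) - G / 2 * s ^ 2 with hH
  have hHd : ∀ s ∈ Icc a b, HasDerivAt H (-((1 + s * ω' s / ω s) ^ 2 / s)) s := fun s hs => by
    have hs' := hsub hs
    have hs0 : s ≠ 0 := hs'.1.ne'
    have hw0 : ω s ≠ 0 := (hpos s hs).ne'
    refine (((((hasDerivAt_id s).mul (h.hasDerivAt' s hs')).div (h.hasDerivAt s hs') hw0).add
      ((((hasDerivAt_id s).mul (h.hasDerivAt s hs')).log (mul_ne_zero hs0 hw0)).const_mul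
        ((n:ℝ) + 6))).sub ((hasDerivAt_pow 2 s).const_mul (G / 2))).congr_deriv ?_
    simp only [Pi.mul_apply, id, hab s hs]
    field_simp
    ring
  have hanti : AntitoneOn H (Icc a b) := by
    refine antitoneOn_of_hasDerivWithinAt_nonpos (convex_Icc a b)
      (fun s hs => (hHd s hs).continuousAt.continuousWithinAt)
      (fun s hs => (hHd s (interior_subset hs)).hasDerivWithinAt) fun s hs => ?_
    have := (hsub (interior_subset hs)).1
    rw [neg_nonpos]
    positivity
  have hbm : b ∈ Icc a b := ⟨hr.1.trans hr.2, le_rfl⟩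
  have hle := hanti hr hbm hr.2
  simp only [hH] at hle
  have hb' := hsub hbm
  have hr' := hsub hr
  have q1 : -1 ≤ b * ω' b / ω b := by
    have := nonneg_of_mul_nonneg_right (h.mul_nonneg hΨ hb') (hpos b hbm)
    rw [le_div_iff₀ (hpos b hbm)]
    linarith
  have q2 : r * ω' r / ω r ≤ 1 := by
    rw [div_le_one (hpos r hr)]
    exact h.mul_deriv_le hΨ0 hΨ hr'
  have hlogb : Real.log (b ^ 2) ≤ Real.log (b * ω b) := by
    refine Real.log_le_log (pow_pos hb'.1 2) ?_
    rw [sq]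
    exact mul_le_mul_of_nonneg_left (h.le_apply hΨ0 hΨ (Ioo_subset_Ioc_self hb')) hb'.1.le
  have hGr : 0 ≤ G / 2 * r ^ 2 := by positivity
  have hn : (0:ℝ) ≤ n := n.cast_nonneg
  have hlog : Real.log (b ^ 2) - 2 ≤ Real.log (r * ω r) := by
    refine le_of_mul_le_mul_left (a := (n:ℝ) + 6) ?_ (by positivity)
    have := mul_le_mul_of_nonneg_left hlogb (by positivity : (0:ℝ) ≤ n + 6)
    nlinarith
  have hz : 0 < r * ω r := mul_pos hr'.1 (hpos r hr)
  rw [← Real.exp_log hz, ← Real.exp_log (pow_pos hb'.1 2), ← Real.exp_add]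
  exact Real.exp_le_exp.2 (by linarith)

theorem ofReal_le_lintegral (h : IsRegularSolution n Ψ ω ω')
    (hΨ0 : ∀ r ∈ Ioo (0:ℝ) 1, 0 ≤ Ψ r)
    (hΨ : ∀ r ∈ Ioo (0:ℝ) 1, r ^ 2 * Ψ r ≤ 2 * (n + 8)) {a b G : ℝ} (ha : 0 < a) (hab : a ≤ b)
    (hb : b < 1) (hG0 : 0 ≤ G) (hG : G * b ^ 2 ≤ 2 * (n + 8))
    (hΨG : ∀ r ∈ Icc a b, Ψ r = 2 * (n + 8) / r ^ 2 - G) :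
    ENNReal.ofReal (Real.exp (-2) * (b ^ 2 * Real.log (b / a))) ≤
      ∫⁻ r in Ioc (0:ℝ) 1, ENNReal.ofReal (ω r) := by
  have hint : IntervalIntegrable (fun r : ℝ => Real.exp (-2) * b ^ 2 * r⁻¹) volume a b :=
    (intervalIntegrable_inv_iff.2
      (Or.inr (notMem_uIcc_of_lt ha (ha.trans_le hab)))).const_mul _
  have e : Real.exp (-2) * (b ^ 2 * Real.log (b / a)) =
      ∫ r in Ioc a b, Real.exp (-2) * b ^ 2 * r⁻¹ := by
    rw [← intervalIntegral.integral_of_le hab, intervalIntegral.integral_const_mul,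
      integral_inv_of_pos ha (ha.trans_le hab), mul_assoc]
  rw [e, ofReal_integral_eq_lintegral_ofReal hint.1]
  · refine le_trans (setLIntegral_mono' measurableSet_Ioc fun r hr => ?_)
      (lintegral_mono_set (Ioc_subset_Ioc ha.le hb.le))
    refine ENNReal.ofReal_le_ofReal ?_
    rw [mul_inv_le_iff₀ (ha.trans hr.1), mul_comm (ω r)]
    exact h.le_mul_apply hΨ0 hΨ ha hb hG0 hG hΨG (Ioc_subset_Icc_self hr)
  · filter_upwards [ae_restrict_mem measurableSet_Ioc] with r hr
    have := ha.trans hr.1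
    positivity

end IsRegularSolution

/-- A smooth cutoff equal to `0` on long intervals `[x k, x k + (x k + 1) e^(2 x k)]` and to `1` on
intervals between them, whose right endpoints are as far out as `f` dictates. -/
theorem exists_cutoff {f : ℝ → ℝ} (hf : Tendsto f atTop atTop) (B : ℕ → ℝ → ℝ) :
    ∃ (x y z : ℕ → ℝ) (η : ℝ → ℝ), ContDiff ℝ (⊤ : ℕ∞) η ∧ (∀ t, η t ∈ Icc (0:ℝ) 1) ∧
      (∀ k : ℕ, (k:ℝ) + 1 ≤ x k) ∧ (∀ k, y k = x k + (x k + 1) * Real.exp (2 * x k)) ∧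
      (∀ k, y k + 1 ≤ z k) ∧ (∀ k, B k (y k) ≤ f (z k)) ∧
      (∀ k, ∀ t ∈ Icc (x k) (y k), η t = 0) ∧ ∀ k, ∀ t ∈ Icc (y k + 1) (z k), η t = 1 := by
  set Y : ℝ → ℝ := fun s => s + (s + 1) * Real.exp (2 * s) with hY
  have hstep : ∀ (k : ℕ) (s : ℝ), ∃ w, Y s + 1 ≤ w ∧ B k (Y s) ≤ f w := fun k s =>
    ((eventually_ge_atTop (Y s + 1)).and (hf.eventually_ge_atTop (B k (Y s)))).exists
  choose Z hZ1 hZ2 using hstep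
  set x : ℕ → ℝ := fun k => Nat.rec 1 (fun k s => Z k s + 1) k with hx
  have hx0 : x 0 = 1 := rfl
  have hxs : ∀ k, x (k + 1) = Z k (x k) + 1 := fun k => rfl
  have hYle : ∀ s, 0 ≤ s → s ≤ Y s := fun s hs => by
    have : 0 ≤ (s + 1) * Real.exp (2 * s) := by positivity
    simp only [hY]; linarith
  have hxk : ∀ k : ℕ, (k:ℝ) + 1 ≤ x k := fun k => by
    induction k with
    | zero => simp [hx0]
    | succ k ih =>
      have h0 : (0:ℝ) ≤ k := k.cast_nonneg
      have := hZ1 k (x k)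
      have := hYle (x k) (by linarith)
      rw [hxs]; push_cast; linarith
  have hxpos : ∀ k, 0 ≤ x k := fun k => by
    have h0 : (0:ℝ) ≤ k := k.cast_nonneg
    have := hxk k
    linarith
  have hsucc : ∀ k, Y (x k) + 2 ≤ x (k + 1) := fun k => by
    have := hZ1 k (x k)
    rw [hxs]; linarith
  have hmono : Monotone x := monotone_nat_of_le_succ fun k => by
    have := hsucc k
    have := hYle (x k) (hxpos k)
    linarith
  have hYlt : ∀ {j k : ℕ}, j < k → Y (x j) + 2 ≤ x k := fun {j k} hjk =>
    (hsucc j).trans (hmono hjk)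
  have hlf : ∀ l u : ℕ → ℝ, (∀ k, x k ≤ l k) → LocallyFinite fun k => Icc (l k) (u k) := by
    intro l u hl t
    refine ⟨Iio (t + 1), Iio_mem_nhds (by linarith), ?_⟩
    obtain ⟨M, hM⟩ := exists_nat_gt (t + 1)
    refine (finite_Iio M).subset ?_
    rintro k ⟨s, hs1, hs2⟩
    have h1 := hxk k
    have h2 := hl k
    have h3 : s < t + 1 := hs2
    have : (k:ℝ) < M := by linarith [hs1.1]
    exact_mod_cast this
  have hA : IsClosed (⋃ k, Icc (x k) (Y (x k))) :=
    (hlf _ _ fun k => le_rfl).isClosed_iUnion fun k => isClosed_Icc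
  have hB : IsClosed (⋃ k, Icc (Y (x k) + 1) (Z k (x k))) :=
    (hlf _ _ fun k => by linarith [hYle (x k) (hxpos k)]).isClosed_iUnion fun k => isClosed_Icc
  have hdisj : Disjoint (⋃ k, Icc (x k) (Y (x k))) (⋃ k, Icc (Y (x k) + 1) (Z k (x k))) := by
    rw [disjoint_left]
    intro t h1 h2
    obtain ⟨j, hj⟩ := mem_iUnion.1 h1
    obtain ⟨k, hk⟩ := mem_iUnion.1 h2
    rcases lt_trichotomy j k with hjk | rfl | hjk
    · linarith [hYlt hjk, hYle (x k) (hxpos k), hj.2, hk.1]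
    · linarith [hj.2, hk.1]
    · have := hmono (Nat.succ_le_of_lt hjk)
      rw [Nat.succ_eq_add_one, hxs] at this
      linarith [hj.1, hk.2]
  obtain ⟨η, h0, h1, h01⟩ := exists_contMDiffMap_zero_one_of_isClosed (n := (⊤ : ℕ∞))
    (modelWithCornersSelf ℝ ℝ) hA hB hdisj
  exact ⟨x, fun k => Y (x k), fun k => Z k (x k), η, η.contMDiff.contDiff, h01, hxk,
    fun k => rfl, fun k => hZ1 k (x k), fun k => hZ2 k (x k),
    fun k t ht => h0 (mem_iUnion.2 ⟨k, ht⟩), fun k t ht => h1 (mem_iUnion.2 ⟨k, ht⟩)⟩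

/-- The profile, in the variable `t = -log r`, of a potential which alternates between growing like
the critical one and being almost constant. -/
theorem exists_profile {f : ℝ → ℝ} (hf : Tendsto f atTop atTop) (c : ℝ) (hc : 0 ≤ c) :
    ∃ (J : ℝ → ℝ) (x y z : ℕ → ℝ), ContDiff ℝ (⊤ : ℕ∞) J ∧ (∀ t, 0 < deriv J t) ∧
      (∀ t, 0 ≤ t → 0 ≤ J t ∧ J t ≤ (Real.exp (2 * t) - 1) / 2) ∧
      (∀ k : ℕ, (k:ℝ) + 1 ≤ x k) ∧ (∀ k, y k = x k + (x k + 1) * Real.exp (2 * x k)) ∧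
      (∀ k, ∀ t ∈ Icc (x k) (y k), J t = J (x k) + (Real.exp (2 * t) - Real.exp (2 * x k)) / 2) ∧
      (∀ k, y k ≤ z k) ∧ ∀ k : ℕ, ((k:ℝ) + 1) * (c + 4 * c * J (z k)) ≤ f (z k) := by
  obtain ⟨x, y, z, η, hη, hη01, hx, hy, hyz, hz, hη0, hη1⟩ := exists_cutoff hf
    fun k s => ((k:ℝ) + 1) * (c + 4 * c * ((Real.exp (2 * (s + 1)) - 1) / 2 + 1))
  set j : ℝ → ℝ := fun t => (1 - η t) * Real.exp (2 * t) + η t * Real.exp (-t) with hj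
  have hjs : ContDiff ℝ (⊤ : ℕ∞) j := by
    have h1 : ContDiff ℝ (⊤ : ℕ∞) fun t : ℝ => Real.exp (2 * t) :=
      (contDiff_const.mul contDiff_id).exp
    have h2 : ContDiff ℝ (⊤ : ℕ∞) fun t : ℝ => Real.exp (-t) := contDiff_id.neg.exp
    exact ((contDiff_const.sub hη).mul h1).add (hη.mul h2)
  have hjc := hjs.continuous
  set J : ℝ → ℝ := fun t => ∫ s in (0:ℝ)..t, j s with hJ
  have hJd : ∀ t, HasDerivAt J (j t) t := fun t =>
    intervalIntegral.integral_hasDerivAt_right (hjc.intervalIntegrable _ _)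
      hjc.aestronglyMeasurable.stronglyMeasurableAtFilter hjc.continuousAt
  have hderiv : deriv J = j := funext fun t => (hJd t).deriv
  have hjpos : ∀ t, 0 < j t := fun t => by
    have h1 := (hη01 t).1
    have h2 := sub_nonneg.2 (hη01 t).2
    rcases h1.eq_or_lt with h | h
    · simp only [hj, ← h]
      positivity
    · have := mul_pos h (Real.exp_pos (-t))
      have := mul_nonneg h2 (Real.exp_pos (2 * t)).le
      simp only [hj]
      linarith
  have hJ0 : J 0 = 0 := by simp [hJ]
  have hJmono : Monotone J :=
    monotone_of_deriv_nonneg (fun t => (hJd t).differentiableAt) fun t => by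
      rw [hderiv]; exact (hjpos t).le
  have hexp : ∀ t, HasDerivAt (fun t : ℝ => Real.exp (2 * t) / 2) (Real.exp (2 * t)) t := fun t =>
    ((((hasDerivAt_id t).const_mul 2).exp).div_const 2).congr_deriv (by simp)
  have hJle : ∀ t, 0 ≤ t → J t ≤ (Real.exp (2 * t) - 1) / 2 := by
    intro t ht
    have hm : MonotoneOn (fun t => Real.exp (2 * t) / 2 - J t) (Ici 0) := by
      refine monotoneOn_of_hasDerivWithinAt_nonneg (convex_Ici 0)
        (fun s _ => ((hexp s).sub (hJd s)).continuousAt.continuousWithinAt)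
        (fun s _ => ((hexp s).sub (hJd s)).hasDerivWithinAt) fun s hs => ?_
      have hs0 : 0 ≤ s := interior_subset hs
      have h1 : Real.exp (-s) ≤ Real.exp (2 * s) := Real.exp_le_exp.2 (by linarith)
      have := mul_le_mul_of_nonneg_left h1 (hη01 s).1
      simp only [hj]
      linarith
    have := hm (mem_Ici.2 le_rfl) ht ht
    simp only [hJ0, mul_zero, Real.exp_zero] at this
    linarith
  have hx0 : ∀ k, 0 ≤ x k := fun k => by
    have h0 : (0:ℝ) ≤ k := k.cast_nonneg
    have := hx k
    linarith
  have hxy : ∀ k, x k ≤ y k := fun k => by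
    have := hx0 k
    have : 0 ≤ (x k + 1) * Real.exp (2 * x k) := by positivity
    rw [hy]; linarith
  refine ⟨J, x, y, z, contDiff_infty_iff_deriv.2
    ⟨fun t => (hJd t).differentiableAt, by rw [hderiv]; exact hjs⟩,
    fun t => by rw [hderiv]; exact hjpos t,
    fun t ht => ⟨by rw [← hJ0]; exact hJmono ht, hJle t ht⟩, hx, hy, fun k t ht => ?_,
    fun k => by linarith [hyz k], fun k => ?_⟩
  · have := constant_of_has_deriv_right_zero (f := fun t => Real.exp (2 * t) / 2 - J t)
      (a := x k) (b := y k)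
      (fun s _ => ((hexp s).sub (hJd s)).continuousAt.continuousWithinAt) (fun s hs => by
        refine (((hexp s).sub (hJd s)).congr_deriv ?_).hasDerivWithinAt
        simp [hj, hη0 k s (Ico_subset_Icc_self hs)]) t ht
    linarith
  · have hneg : ∀ t, HasDerivAt (fun t : ℝ => Real.exp (-t)) (-Real.exp (-t)) t := fun t =>
      ((hasDerivAt_id t).neg.exp).congr_deriv (by simp)
    have h1 := constant_of_has_deriv_right_zero (f := fun t => Real.exp (-t) + J t)
      (a := y k + 1) (b := z k)
      (fun s _ => ((hneg s).add (hJd s)).continuousAt.continuousWithinAt) (fun s hs => by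
        refine (((hneg s).add (hJd s)).congr_deriv ?_).hasDerivWithinAt
        simp [hj, hη1 k s (Ico_subset_Icc_self hs)]) (z k) ⟨hyz k, le_rfl⟩
    have hy0 : 0 ≤ y k + 1 := by linarith [hx0 k, hxy k]
    have h2 := hJle _ hy0
    have h3 : Real.exp (-(y k + 1)) ≤ 1 := Real.exp_le_one_iff.2 (by linarith)
    have h4 := Real.exp_pos (-z k)
    refine le_trans ?_ (hz k)
    gcongr
    linarith

theorem isRegularSolution_of_isRadialSolution {n : ℕ} {Ψ ω ω' : ℝ → ℝ}
    (hΨ : ContinuousOn Ψ (Ioo 0 1)) (h : IsRadialSolution (n + 10) Ψ ω ω') :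
    IsRegularSolution n Ψ ω ω' := by
  obtain ⟨hd, hc, h1, hint, hweak⟩ := h
  have hcast : (((n + 10 : ℕ) : ℝ) - 1) = n + 9 := by push_cast; ring
  rw [hcast, show n + 10 - 1 = n + 9 from rfl] at hweak
  rw [show n + 10 - 1 = n + 9 from rfl] at hint
  have hω : ContinuousOn ω (Ioc 0 1) := fun r hr => (hd r hr).continuousWithinAt
  have hsub : Ioo (0:ℝ) 1 ⊆ Ioc 0 1 := Ioo_subset_Ioc_self
  have hWd := hasDerivAt_of_weak (W := fun r => r ^ (n + 9) * ω' r)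
    (K := fun r => r ^ (n + 9) * (((n + 9) / r ^ 2 - Ψ r) * ω r))
    ((continuous_pow _).continuousOn.mul (hc.mono hsub))
    ((continuous_pow _).continuousOn.mul (((continuousOn_const.div (continuous_pow 2).continuousOn
      fun r hr => (pow_pos hr.1 2).ne').sub hΨ).mul (hω.mono hsub)))
    (fun v hv hv1 => by
      rw [hweak v hv hv1, ← intervalIntegral.integral_neg]
      congr 1
      ext r
      ring)
  refine ⟨hω, h1, fun r hr => (hd r (hsub hr)).hasDerivAt (Ioc_mem_nhds hr.1 hr.2),
    fun r hr => ?_, fun ρ hρ ε hε => ?_⟩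
  · have hr0 : r ≠ 0 := hr.1.ne'
    have hq := (hWd r hr).div (hasDerivAt_pow (n + 9) r) (pow_ne_zero _ hr0)
    refine (hq.congr_of_eventuallyEq ?_).congr_deriv ?_
    · filter_upwards [Ioi_mem_nhds hr.1] with s hs
      have : s ^ (n + 9) ≠ 0 := pow_ne_zero _ (ne_of_gt hs)
      simp only [Pi.div_apply]
      field_simp
    · rw [show n + 9 - 1 = n + 8 from rfl]
      push_cast
      field_simp
      ring
  · obtain ⟨r, hr, hlt⟩ := exists_mul_lt_of_intervalIntegrable hint hρ.1 hρ.2.le hε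
    exact ⟨r, hr, by rw [pow_succ']; linarith⟩

theorem stmt12 (N : ℕ) (hN : 10 ≤ N) (φ : ℝ → ℝ)
    (hφpos : ∀ r ∈ Set.Ioo (0:ℝ) 1, 0 < φ r)
    (hφlim : Tendsto φ (nhdsWithin 0 (Set.Ioi 0)) atTop) :
    ∃ Ψ : ℝ → ℝ,
      ContDiffOn ℝ (⊤ : ℕ∞) Ψ (Set.Ioc 0 1) ∧
      (∀ r ∈ Set.Ioc (0:ℝ) 1, 0 < Ψ r ∧ Ψ r ≤ 2 * ((N:ℝ) - 2) / r ^ 2) ∧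
      (∀ r ∈ Set.Ioc (0:ℝ) 1, derivWithin Ψ (Set.Ioc 0 1) r < 0) ∧
      Filter.liminf (fun r => Ψ r / φ r) (nhdsWithin 0 (Set.Ioi 0)) = 0 ∧
      Filter.limsup (fun r => r ^ 2 * Ψ r) (nhdsWithin 0 (Set.Ioi 0)) = 2 * ((N:ℝ) - 2) ∧
      ∀ ω ω' : ℝ → ℝ, IsRadialSolution N Ψ ω ω' →
        (∫⁻ r in Set.Ioc (0:ℝ) 1, ENNReal.ofReal (ω r)) = ⊤ := by
  obtain ⟨n, rfl⟩ := Nat.exists_eq_add_of_le' hN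
  have hexp : Tendsto (fun t : ℝ => Real.exp (-t)) atTop (nhdsWithin 0 (Ioi 0)) :=
    tendsto_nhdsWithin_iff.2 ⟨Real.tendsto_exp_neg_atTop_nhds_zero,
      Eventually.of_forall fun t => Real.exp_pos _⟩
  set c : ℝ := (n:ℝ) + 8 with hc
  have hc0 : 0 < c := by positivity
  have hcast : ((n + 10 : ℕ) : ℝ) - 2 = c := by rw [hc]; push_cast; ring
  rw [hcast]
  obtain ⟨J, x, y, z, hJs, hJpos, hJle, hx, hy, hJxy, hyz, hz⟩ :=
    exists_profile (hφlim.comp hexp) c hc0.le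
  have hk0 : ∀ k : ℕ, (0:ℝ) ≤ k := fun k => k.cast_nonneg
  have hx1 : ∀ k, 1 ≤ x k := fun k => by linarith [hx k, hk0 k]
  have hlen : ∀ k : ℕ, (k:ℝ) + 1 ≤ y k - x k := fun k => by
    have h1 : 1 ≤ Real.exp (2 * x k) := Real.one_le_exp (by linarith [hx1 k])
    have := mul_le_mul_of_nonneg_left h1 (by linarith [hx1 k] : 0 ≤ x k + 1)
    rw [hy]
    linarith [hx k]
  set Ψ : ℝ → ℝ := fun r => c + 4 * c * J (-Real.log r) with hΨ
  have hexplog : ∀ r : ℝ, 0 < r → Real.exp (2 * -Real.log r) = (r ^ 2)⁻¹ := fun r hr => by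
    rw [show 2 * -Real.log r = -(2 * Real.log r) by ring, Real.exp_neg,
      show 2 * Real.log r = Real.log (r ^ 2) by rw [Real.log_pow]; norm_num,
      Real.exp_log (pow_pos hr 2)]
  have hΨe : ∀ t, Ψ (Real.exp (-t)) = c + 4 * c * J t := fun t => by
    simp only [hΨ, Real.log_exp, neg_neg]
  have hΨs : ContDiffOn ℝ (⊤ : ℕ∞) Ψ (Ioc 0 1) := by
    have hlog : ContDiffOn ℝ (⊤ : ℕ∞) (fun r => -Real.log r) (Ioc 0 1) :=
      (contDiffOn_id.log fun r hr => hr.1.ne').neg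
    exact contDiffOn_const.add (contDiffOn_const.mul (hJs.comp_contDiffOn hlog))
  have hΨ0 : ∀ r ∈ Ioc (0:ℝ) 1, 0 < Ψ r := fun r hr => by
    have := (hJle (-Real.log r) (neg_nonneg.2 (Real.log_nonpos hr.1.le hr.2))).1
    simp only [hΨ]
    positivity
  have hΨle : ∀ r ∈ Ioc (0:ℝ) 1, Ψ r ≤ 2 * c / r ^ 2 := fun r hr => by
    have := (hJle (-Real.log r) (neg_nonneg.2 (Real.log_nonpos hr.1.le hr.2))).2
    rw [hexplog r hr.1] at this
    have := mul_le_mul_of_nonneg_left this (by positivity : 0 ≤ 4 * c)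
    rw [div_eq_mul_inv]
    simp only [hΨ]
    linarith
  have hΨle' : ∀ r ∈ Ioc (0:ℝ) 1, r ^ 2 * Ψ r ≤ 2 * c := fun r hr => by
    have := hΨle r hr
    rwa [le_div_iff₀ (pow_pos hr.1 2), mul_comm] at this
  have hnear : ∀ᶠ r in nhdsWithin (0:ℝ) (Ioi 0), r ∈ Ioo (0:ℝ) 1 :=
    Ioo_mem_nhdsGT zero_lt_one
  have hgap : ∀ k, ∀ t ∈ Icc (x k) (y k),
      Ψ (Real.exp (-t)) = 2 * c * Real.exp (2 * t) - (2 * c * Real.exp (2 * x k) - c -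
        4 * c * J (x k)) := fun k t ht => by
    rw [hΨe, hJxy k t ht]; ring
  have hG0 : ∀ k, 0 ≤ 2 * c * Real.exp (2 * x k) - c - 4 * c * J (x k) := fun k => by
    have := mul_le_mul_of_nonneg_left (hJle (x k) (by linarith [hx1 k])).2
      (by positivity : 0 ≤ 4 * c)
    linarith
  have hGle : ∀ k, 2 * c * Real.exp (2 * x k) - c - 4 * c * J (x k) ≤
      2 * c * Real.exp (2 * x k) := fun k => by
    have := mul_nonneg (by positivity : 0 ≤ 4 * c) (hJle (x k) (by linarith [hx1 k])).1
    linarith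
  have htop : ∀ u : ℕ → ℝ, (∀ k : ℕ, (k:ℝ) ≤ u k) → Tendsto u atTop atTop := fun u hu =>
    tendsto_atTop_mono hu tendsto_natCast_atTop_atTop
  refine ⟨Ψ, hΨs, fun r hr => ⟨hΨ0 r hr, hΨle r hr⟩, fun r hr => ?_, ?_, ?_, ?_⟩
  · have hd : HasDerivAt Ψ (4 * c * (deriv J (-Real.log r) * -r⁻¹)) r :=
      (((hJs.differentiable (by simp) _).hasDerivAt.comp r
        (Real.hasDerivAt_log hr.1.ne').neg).const_mul (4 * c)).const_add c
    rw [hd.hasDerivWithinAt.derivWithin (uniqueDiffOn_Ioc 0 1 r hr)]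
    have := mul_pos (hJpos (-Real.log r)) (inv_pos.2 hr.1)
    have := mul_pos (by positivity : 0 < 4 * c) this
    linarith
  · have hnonneg : ∀ᶠ r in nhdsWithin (0:ℝ) (Ioi 0), 0 ≤ Ψ r / φ r := by
      filter_upwards [hnear] with r hr
      exact (div_pos (hΨ0 r (Ioo_subset_Ioc_self hr)) (hφpos r hr)).le
    have hfreq : ∀ ε > 0, ∃ᶠ r in nhdsWithin (0:ℝ) (Ioi 0), Ψ r / φ r ≤ ε := by
      intro ε hε
      have hzt : Tendsto (fun k => Real.exp (-z k)) atTop (nhdsWithin 0 (Ioi 0)) :=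
        hexp.comp (htop z fun k => by linarith [hx1 k, hlen k, hyz k])
      refine hzt.frequently (Eventually.frequently ?_)
      obtain ⟨M, hM⟩ := exists_nat_gt ε⁻¹
      filter_upwards [eventually_ge_atTop M, hzt.eventually hnear] with k hk hmem
      have hφk := hφpos _ hmem
      have hΨk := hΨ0 _ (Ioo_subset_Ioc_self hmem)
      have hzk : ((k:ℝ) + 1) * Ψ (Real.exp (-z k)) ≤ φ (Real.exp (-z k)) := by
        rw [hΨe]; exact hz k
      have hMk : (M:ℝ) ≤ k := by exact_mod_cast hk
      have h1 : ε⁻¹ * Ψ (Real.exp (-z k)) ≤ φ (Real.exp (-z k)) :=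
        (mul_le_mul_of_nonneg_right (by linarith) hΨk.le).trans hzk
      rwa [div_le_iff₀ hφk, ← inv_mul_le_iff₀ hε]
    refine le_antisymm (le_of_forall_pos_le_add fun ε hε => ?_) ?_
    · rw [zero_add]
      exact liminf_le_of_frequently_le (hfreq ε hε) ⟨0, hnonneg⟩
    · exact le_liminf_of_le (IsCoboundedUnder.of_frequently_le (hfreq 1 one_pos)) hnonneg
  · have hbdd : ∀ᶠ r in nhdsWithin (0:ℝ) (Ioi 0), r ^ 2 * Ψ r ≤ 2 * c := by
      filter_upwards [hnear] with r hr using hΨle' r (Ioo_subset_Ioc_self hr)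
    have hfreq : ∀ ε > 0, ∃ᶠ r in nhdsWithin (0:ℝ) (Ioi 0), 2 * c - ε ≤ r ^ 2 * Ψ r := by
      intro ε hε
      have hyt : Tendsto (fun k => Real.exp (-y k)) atTop (nhdsWithin 0 (Ioi 0)) :=
        hexp.comp (htop y fun k => by linarith [hx1 k, hlen k])
      refine hyt.frequently (Eventually.frequently ?_)
      have hlim : Tendsto (fun k => 2 * c * Real.exp (-(2 * (y k - x k)))) atTop (nhds 0) := by
        have := (Real.tendsto_exp_neg_atTop_nhds_zero.comp
          (htop (fun k => 2 * (y k - x k)) fun k => by linarith [hlen k, hk0 k])).const_mul (2 * c)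
        simpa using this
      filter_upwards [hlim.eventually_le_const hε] with k hk
      have hxyk : x k ≤ y k := by linarith [hlen k, hk0 k]
      rw [hgap k (y k) ⟨hxyk, le_rfl⟩, ← Real.exp_nat_mul]
      have e1 : Real.exp ((2:ℕ) * -y k) * Real.exp (2 * y k) = 1 := by
        rw [← Real.exp_add, ← Real.exp_zero]; congr 1; push_cast; ring
      have e2 : Real.exp ((2:ℕ) * -y k) * Real.exp (2 * x k) =
          Real.exp (-(2 * (y k - x k))) := by
        rw [← Real.exp_add]; congr 1; push_cast; ring
      have h1 := mul_le_mul_of_nonneg_left (hGle k) (Real.exp_pos ((2:ℕ) * -y k)).le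
      have h2 : Real.exp ((2:ℕ) * -y k) * (2 * c * Real.exp (2 * x k)) ≤ ε := by
        rw [mul_left_comm, e2]; exact hk
      rw [mul_sub, mul_left_comm, e1]
      linarith
    refine le_antisymm ?_ (le_of_forall_pos_le_add fun ε hε => ?_)
    · exact limsup_le_of_le (IsCoboundedUnder.of_frequently_ge (hfreq 1 one_pos)) hbdd
    · exact sub_le_iff_le_add.1 (le_limsup_of_frequently_le (hfreq ε hε) ⟨2 * c, hbdd⟩)
  · intro ω ω' hω
    have hsub : Ioo (0:ℝ) 1 ⊆ Ioc 0 1 := Ioo_subset_Ioc_self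
    have hreg := isRegularSolution_of_isRadialSolution (hΨs.continuousOn.mono hsub) hω
    have hlow : ∀ k : ℕ, ENNReal.ofReal (Real.exp (-2) * k) ≤
        ∫⁻ r in Ioc (0:ℝ) 1, ENNReal.ofReal (ω r) := by
      intro k
      have hxyk : x k ≤ y k := by linarith [hlen k, hk0 k]
      have hsq : Real.exp (-x k) ^ 2 * Real.exp (2 * x k) = 1 := by
        rw [← Real.exp_nat_mul, ← Real.exp_add, ← Real.exp_zero]; congr 1; push_cast; ring
      refine le_trans ?_ (hreg.ofReal_le_lintegral (fun r hr => (hΨ0 r (hsub hr)).le)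
        (fun r hr => hΨle' r (hsub hr)) (Real.exp_pos (-y k)) (b := Real.exp (-x k))
        (Real.exp_le_exp.2 (neg_le_neg hxyk))
        (Real.exp_lt_one_iff.2 (by linarith [hx1 k])) (hG0 k) ?_ fun r hr => ?_)
      · refine ENNReal.ofReal_le_ofReal (mul_le_mul_of_nonneg_left ?_ (Real.exp_pos _).le)
        rw [← Real.exp_sub, Real.log_exp, show -x k - -y k = (x k + 1) * Real.exp (2 * x k) by
          rw [hy]; ring, mul_left_comm, hsq]
        linarith [hx k]
      · have := mul_le_mul_of_nonneg_right (hGle k) (sq_nonneg (Real.exp (-x k)))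
        refine this.trans_eq ?_
        rw [mul_assoc, mul_comm (Real.exp (2 * x k)), hsq, mul_one]
      · have hr0 : 0 < r := (Real.exp_pos _).trans_le hr.1
        have hm : -Real.log r ∈ Icc (x k) (y k) := by
          have h1 := (Real.le_log_iff_exp_le hr0).2 hr.1
          have h2 := (Real.log_le_iff_le_exp hr0).2 hr.2
          constructor <;> linarith
        have := hgap k _ hm
        rwa [neg_neg, Real.exp_log hr0, hexplog r hr0, ← div_eq_mul_inv] at this
    refine ENNReal.eq_top_of_forall_nnreal_le fun q => ?_
    obtain ⟨k, hk⟩ := exists_nat_gt ((q:ℝ) / Real.exp (-2))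
    refine le_trans ?_ (hlow k)
    rw [ENNReal.le_ofReal_iff_toReal_le ENNReal.coe_ne_top (by positivity), ENNReal.coe_toReal]
    rw [div_lt_iff₀ (Real.exp_pos _)] at hk
    linarith
end

section
/- Let N ≥ 10 be an integer and let φ : (0,1) → (0,∞) satisfy lim_{r→0⁺} φ(r) = +∞. Then there exist a C^∞ function f : [0,∞) → ℝ satisfying condition (★) and a C^∞ function u : (0,1] → ℝ such that: u(1) = 0; u'(r) < 0 for every r ∈ (0,1]; lim_{r→0⁺} u(r) = +∞; ∫₀¹ r^{N−1}(u(r)² + u'(r)²) dr < ∞; −u''(r) − ((N−1)/r)·u'(r) = f(u(r)) for every r ∈ (0,1]; f'(u(r)) ≤ 2(N−2)/r² for every r ∈ (0,1]; and liminf_{r→0⁺} f'(u(r))/φ(r) = 0. -/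
open MeasureTheory Filter Set

/-- Condition (★): `f` is `C¹`, nondecreasing, convex, `f 0 > 0`, and superlinear at `+∞`,
all on the domain `[0,∞)`. -/
def StarCond (f : ℝ → ℝ) : Prop :=
  ContDiffOn ℝ 1 f (Set.Ici 0) ∧ MonotoneOn f (Set.Ici 0) ∧
    ConvexOn ℝ (Set.Ici 0) f ∧ 0 < f 0 ∧
    Tendsto (fun t => f t / t) atTop atTop


/-- The moment `∑ aᵢ / (sᵢ + x) ^ k` of a discrete Stieltjes measure. -/
noncomputable def stieltjesMoment (a s : ℕ → ℝ) (k : ℕ) (x : ℝ) : ℝ :=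
  ∑' i, a i / (s i + x) ^ k

/-- The logarithmic potential `½ ∑ aᵢ log ((1 + sᵢ) / (sᵢ + x))`, vanishing at `x = 1`. -/
noncomputable def logPotential (a s : ℕ → ℝ) (x : ℝ) : ℝ :=
  ∑' i, a i * (Real.log (1 + s i) - Real.log (s i + x)) / 2

section Moments

variable {a s : ℕ → ℝ}

theorem div_add_pow_le (ha : ∀ i, 0 < a i) (hs : ∀ i, 0 < s i) (k : ℕ) {x y : ℝ} (hy : 0 < y)
    (hyx : y ≤ x) (i : ℕ) : a i / (s i + x) ^ k ≤ a i / y ^ k := by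
  have := ha i
  have := hs i
  gcongr
  linarith

theorem summable_stieltjesMoment (ha : ∀ i, 0 < a i) (hs : ∀ i, 0 < s i) (hsum : Summable a)
    (k : ℕ) {x : ℝ} (hx : 0 < x) : Summable fun i => a i / (s i + x) ^ k := by
  refine Summable.of_nonneg_of_le (fun i => ?_)
    (fun i => div_add_pow_le ha hs k hx le_rfl i) (hsum.div_const (x ^ k))
  have := ha i
  have := hs i
  positivity

theorem stieltjesMoment_pos (ha : ∀ i, 0 < a i) (hs : ∀ i, 0 < s i) (hsum : Summable a)
    (k : ℕ) {x : ℝ} (hx : 0 < x) : 0 < stieltjesMoment a s k x := by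
  have h : ∀ i, 0 < a i / (s i + x) ^ k := fun i => by
    have := ha i
    have := hs i
    positivity
  exact (summable_stieltjesMoment ha hs hsum k hx).tsum_pos (fun i => (h i).le) 0 (h 0)

theorem stieltjesMoment_le (ha : ∀ i, 0 < a i) (hs : ∀ i, 0 < s i) (hsum : Summable a)
    (k : ℕ) {x : ℝ} (hx : 0 < x) : stieltjesMoment a s k x ≤ (∑' i, a i) / x ^ k := by
  rw [← tsum_div_const]
  exact (summable_stieltjesMoment ha hs hsum k hx).tsum_le_tsum
    (fun i => div_add_pow_le ha hs k hx le_rfl i) (hsum.div_const _)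

theorem mul_stieltjesMoment_succ_le (ha : ∀ i, 0 < a i) (hs : ∀ i, 0 < s i) (hsum : Summable a)
    (k : ℕ) {x : ℝ} (hx : 0 < x) :
    x * stieltjesMoment a s (k + 1) x ≤ stieltjesMoment a s k x := by
  unfold stieltjesMoment
  rw [← tsum_mul_left]
  refine Summable.tsum_le_tsum (fun i => ?_)
    ((summable_stieltjesMoment ha hs hsum (k + 1) hx).mul_left x)
    (summable_stieltjesMoment ha hs hsum k hx)
  have h1 := ha i
  have h2 := hs i
  have h3 : 0 < s i + x := by positivity
  rw [mul_div_assoc', div_le_div_iff₀ (by positivity) (by positivity), pow_succ]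
  have : 0 < a i * (s i + x) ^ k := by positivity
  nlinarith [mul_pos this h2]

/-- Log-convexity of the moments in the exponent. -/
theorem stieltjesMoment_two_sq_le (ha : ∀ i, 0 < a i) (hs : ∀ i, 0 < s i) (hsum : Summable a)
    {x : ℝ} (hx : 0 < x) :
    stieltjesMoment a s 2 x ^ 2 ≤ stieltjesMoment a s 1 x * stieltjesMoment a s 3 x := by
  have S := fun k => (summable_stieltjesMoment ha hs hsum k hx).hasSum
  have hpos := stieltjesMoment_pos ha hs hsum 1 hx
  have key : ∀ l : ℝ, 0 ≤ stieltjesMoment a s 3 x - 2 * l * stieltjesMoment a s 2 x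
      + l ^ 2 * stieltjesMoment a s 1 x := fun l => by
    refine (((S 3).sub ((S 2).mul_left (2 * l))).add ((S 1).mul_left (l ^ 2))).nonneg
      fun i => ?_
    have h1 := ha i
    have h2 := hs i
    have h3 : 0 < s i + x := by positivity
    have : a i / (s i + x) ^ 3 - 2 * l * (a i / (s i + x) ^ 2) + l ^ 2 * (a i / (s i + x) ^ 1)
        = a i / (s i + x) * (1 / (s i + x) - l) ^ 2 := by
      field_simp
      ring
    rw [this]
    positivity
  have h := key (stieltjesMoment a s 2 x / stieltjesMoment a s 1 x)
  have h2 := mul_nonneg hpos.le h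
  field_simp at h2
  nlinarith

theorem hasDerivAt_stieltjesMoment (ha : ∀ i, 0 < a i) (hs : ∀ i, 0 < s i) (hsum : Summable a)
    (k : ℕ) {x : ℝ} (hx : 0 < x) :
    HasDerivAt (stieltjesMoment a s k) (-k * stieltjesMoment a s (k + 1) x) x := by
  have hmem : x ∈ Ioi (x / 2) := by simp [hx]
  have h := hasDerivAt_tsum_of_isPreconnected (𝕜 := ℝ) (t := Ioi (x / 2))
    (g := fun i y => a i / (s i + y) ^ k) (g' := fun i y => -k * (a i / (s i + y) ^ (k + 1)))
    (u := fun i => k * (a i / (x / 2) ^ (k + 1))) ((hsum.div_const _).mul_left _)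
    isOpen_Ioi isPreconnected_Ioi (fun i y hy => ?_) (fun i y hy => ?_) hmem
    (summable_stieltjesMoment ha hs hsum k hx) hmem
  · rw [tsum_mul_left] at h
    exact h
  · have hy0 : 0 < y := lt_trans (half_pos hx) hy
    have h2 := hs i
    have h3 : s i + y ≠ 0 := by positivity
    have h4 := (((hasDerivAt_id y).const_add (s i)).pow k).fun_inv (pow_ne_zero k h3)
    have h5 := h4.const_mul (a i)
    refine (h5.congr_deriv ?_).congr_of_eventuallyEq ?_
    · rcases k with _ | k
      · simp
      · simp only [id, Nat.add_sub_cancel, Pi.pow_apply]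
        field_simp
        ring
    · exact Eventually.of_forall fun z => by simp [div_eq_mul_inv]
  · have hy0 : x / 2 < y := hy
    have h1 := ha i
    have h2 := hs i
    have : 0 < s i + y := by linarith
    rw [norm_mul, norm_neg, Real.norm_natCast, Real.norm_of_nonneg (by positivity)]
    gcongr
    linarith

theorem contDiffOn_stieltjesMoment (ha : ∀ i, 0 < a i) (hs : ∀ i, 0 < s i) (hsum : Summable a)
    (k : ℕ) : ContDiffOn ℝ (⊤ : ℕ∞) (stieltjesMoment a s k) (Ioi 0) := by
  rw [contDiffOn_infty]
  intro n
  induction n generalizing k with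
  | zero =>
    rw [Nat.cast_zero, contDiffOn_zero]
    exact fun x hx => (hasDerivAt_stieltjesMoment ha hs hsum k hx).continuousAt.continuousWithinAt
  | succ n ih =>
    rw [Nat.cast_succ, contDiffOn_succ_iff_deriv_of_isOpen isOpen_Ioi]
    refine ⟨fun x hx => ?_, by simp, ?_⟩
    · exact (hasDerivAt_stieltjesMoment ha hs hsum k hx).differentiableAt.differentiableWithinAt
    · exact (contDiffOn_const.mul (ih (k + 1))).congr
        fun x hx => (hasDerivAt_stieltjesMoment ha hs hsum k hx).deriv

theorem hasDerivAt_log_term (hs : ∀ i, 0 < s i) (i : ℕ) {y : ℝ} (hy : 0 < y) :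
    HasDerivAt (fun y => a i * (Real.log (1 + s i) - Real.log (s i + y)) / 2)
      (-1 / 2 * (a i / (s i + y) ^ 1)) y := by
  have h2 := hs i
  have h3 : s i + y ≠ 0 := by positivity
  have h4 := ((((hasDerivAt_id y).const_add (s i)).log h3).const_sub
    (Real.log (1 + s i))).const_mul (a i) |>.div_const 2
  refine h4.congr_deriv ?_
  simp only [id]
  field_simp

theorem log_term_bounds (ha : ∀ i, 0 < a i) (hs : ∀ i, 0 < s i) {x : ℝ} (hx : 0 < x) :
    (∀ i, ∀ y ∈ Ioi (min x 1 / 2), HasDerivAt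
      (fun y => a i * (Real.log (1 + s i) - Real.log (s i + y)) / 2)
      (-1 / 2 * (a i / (s i + y) ^ 1)) y) ∧
    (∀ i, ∀ y ∈ Ioi (min x 1 / 2), ‖-1 / 2 * (a i / (s i + y) ^ 1)‖
      ≤ a i / (min x 1 / 2) ^ 1) := by
  have hm : 0 < min x 1 / 2 := by positivity
  refine ⟨fun i y hy => hasDerivAt_log_term hs i (hm.trans hy), fun i y hy => ?_⟩
  have h1 := ha i
  have h2 := hs i
  have : 0 < s i + y := by linarith [hm.trans hy]
  rw [norm_mul, Real.norm_of_nonneg (by positivity : 0 ≤ a i / (s i + y) ^ 1)]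
  have h5 := div_add_pow_le ha hs 1 hm (le_of_lt hy) i
  have h6 : 0 ≤ a i / (s i + y) ^ 1 := by positivity
  norm_num at *
  linarith

theorem half_min_lt_self {x : ℝ} (hx : 0 < x) : x ∈ Ioi (min x 1 / 2) := by
  have := min_le_left x 1
  simp only [mem_Ioi]
  linarith

theorem half_min_lt_one {x : ℝ} : (1 : ℝ) ∈ Ioi (min x 1 / 2) := by
  have := min_le_right x 1
  simp only [mem_Ioi]
  linarith

theorem summable_logPotential (ha : ∀ i, 0 < a i) (hs : ∀ i, 0 < s i) (hsum : Summable a)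
    {x : ℝ} (hx : 0 < x) :
    Summable fun i => a i * (Real.log (1 + s i) - Real.log (s i + x)) / 2 :=
  summable_of_summable_hasDerivAt_of_isPreconnected (𝕜 := ℝ)
    (g := fun i y => a i * (Real.log (1 + s i) - Real.log (s i + y)) / 2)
    (hsum.div_const _) isOpen_Ioi isPreconnected_Ioi (log_term_bounds ha hs hx).1
    (log_term_bounds ha hs hx).2 half_min_lt_one (by simp [add_comm, summable_zero])
    (half_min_lt_self hx)

theorem hasDerivAt_logPotential (ha : ∀ i, 0 < a i) (hs : ∀ i, 0 < s i) (hsum : Summable a)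
    {x : ℝ} (hx : 0 < x) :
    HasDerivAt (logPotential a s) (-1 / 2 * stieltjesMoment a s 1 x) x := by
  have h := hasDerivAt_tsum_of_isPreconnected (𝕜 := ℝ)
    (g := fun i y => a i * (Real.log (1 + s i) - Real.log (s i + y)) / 2)
    (hsum.div_const _) isOpen_Ioi isPreconnected_Ioi (log_term_bounds ha hs hx).1
    (log_term_bounds ha hs hx).2 half_min_lt_one (by simp [add_comm, summable_zero])
    (half_min_lt_self hx)
  rwa [tsum_mul_left] at h

theorem contDiffOn_logPotential (ha : ∀ i, 0 < a i) (hs : ∀ i, 0 < s i) (hsum : Summable a) :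
    ContDiffOn ℝ (⊤ : ℕ∞) (logPotential a s) (Ioi 0) := by
  rw [contDiffOn_infty_iff_deriv_of_isOpen isOpen_Ioi]
  exact ⟨fun x hx =>
    (hasDerivAt_logPotential ha hs hsum hx).differentiableAt.differentiableWithinAt,
    (contDiffOn_const.mul (contDiffOn_stieltjesMoment ha hs hsum 1)).congr
      fun x hx => (hasDerivAt_logPotential ha hs hsum hx).deriv⟩

theorem logPotential_one : logPotential a s 1 = 0 := by
  simp [logPotential, add_comm]

/-- The logarithmic potential is sublinear with respect to the first moment. -/
theorem mul_logPotential_le (ha : ∀ i, 0 < a i) (hs : ∀ i, 0 < s i) (hs1 : ∀ i, s i ≤ 1)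
    (hsum : Summable a) {x K : ℝ} (hx : 0 < x) (hK : 0 < K) :
    K * logPotential a s x ≤ stieltjesMoment a s 1 x + K ^ 2 * ∑' i, a i := by
  unfold logPotential stieltjesMoment
  rw [← tsum_mul_left, ← tsum_mul_left, ← Summable.tsum_add
    (summable_stieltjesMoment ha hs hsum 1 hx) (hsum.mul_left _)]
  refine Summable.tsum_le_tsum (fun i => ?_) ((summable_logPotential ha hs hsum hx).mul_left _)
    ((summable_stieltjesMoment ha hs hsum 1 hx).add (hsum.mul_left _))
  have h1 := ha i
  have h2 := hs i
  have h3 : 0 < s i + x := by positivity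
  have e1 : Real.log (K * (1 + s i)) ≤ K * (1 + s i) - 1 :=
    Real.log_le_sub_one_of_pos (by positivity)
  have e2 : Real.log (1 / (K * (s i + x))) ≤ 1 / (K * (s i + x)) - 1 :=
    Real.log_le_sub_one_of_pos (by positivity)
  rw [Real.log_mul (by positivity) (by positivity)] at e1
  rw [one_div, Real.log_inv, Real.log_mul (by positivity) (by positivity)] at e2
  have e3 : Real.log (1 + s i) - Real.log (s i + x) ≤ 2 * K + (K * (s i + x))⁻¹ := by
    nlinarith [hs1 i]
  have e4 : K * (a i * (Real.log (1 + s i) - Real.log (s i + x)) / 2)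
      ≤ K * a i / 2 * (2 * K + (K * (s i + x))⁻¹) := by
    have : 0 ≤ K * a i / 2 := by positivity
    nlinarith [mul_le_mul_of_nonneg_left e3 this]
  have e5 : K * a i / 2 * (2 * K + (K * (s i + x))⁻¹)
      = K ^ 2 * a i + 1 / 2 * (a i / (s i + x) ^ 1) := by
    field_simp
  have e6 : 0 ≤ a i / (s i + x) ^ 1 := by positivity
  linarith

theorem strictAntiOn_logPotential (ha : ∀ i, 0 < a i) (hs : ∀ i, 0 < s i) (hsum : Summable a) :
    StrictAntiOn (logPotential a s) (Ioi 0) := by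
  refine strictAntiOn_of_deriv_neg (convex_Ioi 0)
    (contDiffOn_logPotential ha hs hsum).continuousOn fun x hx => ?_
  rw [interior_Ioi] at hx
  rw [(hasDerivAt_logPotential ha hs hsum hx).deriv]
  linarith [stieltjesMoment_pos ha hs hsum 1 hx]

theorem le_logPotential (ha : ∀ i, 0 < a i) (hs : ∀ i, 0 < s i) (hsum : Summable a)
    {x : ℝ} (hx : 0 < x) (hx1 : x ≤ 1) (n : ℕ) :
    a n * (Real.log (1 + s n) - Real.log (s n + x)) / 2 ≤ logPotential a s x := by
  refine (summable_logPotential ha hs hsum hx).le_tsum n fun i _ => ?_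
  have h1 := ha i
  have h2 := hs i
  have : Real.log (s i + x) ≤ Real.log (1 + s i) :=
    Real.log_le_log (by positivity) (by linarith)
  have : 0 ≤ Real.log (1 + s i) - Real.log (s i + x) := by linarith
  positivity

theorem logPotential_le (ha : ∀ i, 0 < a i) (hs : ∀ i, 0 < s i) (hsum : Summable a)
    {x : ℝ} (hx1 : 1 ≤ x) (n : ℕ) :
    logPotential a s x ≤ a n * (Real.log (1 + s n) - Real.log (s n + x)) / 2 := by
  have hx : 0 < x := by linarith
  have h := (summable_logPotential ha hs hsum hx).neg.le_tsum n fun i _ => ?_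
  · rw [tsum_neg] at h
    exact neg_le_neg_iff.mp h
  have h1 := ha i
  have h2 := hs i
  have : Real.log (1 + s i) ≤ Real.log (s i + x) :=
    Real.log_le_log (by positivity) (by linarith)
  nlinarith

theorem tendsto_logPotential_atTop (ha : ∀ i, 0 < a i) (hs : ∀ i, 0 < s i) (hsum : Summable a) :
    Tendsto (logPotential a s) atTop atBot := by
  have h : Tendsto (fun x => a 0 * (Real.log (1 + s 0) - Real.log (s 0 + x)) / 2) atTop atBot := by
    refine Tendsto.atBot_div_const (by norm_num) (Tendsto.const_mul_atBot (ha 0) ?_)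
    refine tendsto_atBot_add_const_left _ _ (tendsto_neg_atTop_atBot.comp
      (Real.tendsto_log_atTop.comp (tendsto_atTop_add_const_left _ _ tendsto_id)))
  refine tendsto_atBot_mono' _ ?_ h
  filter_upwards [eventually_ge_atTop 1] with x hx using logPotential_le ha hs hsum hx 0

theorem tendsto_logPotential_zero (ha : ∀ i, 0 < a i) (hs : ∀ i, 0 < s i) (hs1 : ∀ i, s i ≤ 1)
    (hsum : Summable a) (hlog : ∀ n : ℕ, 2 * n ≤ a n * - Real.log (2 * s n)) :
    Tendsto (logPotential a s) (nhdsWithin 0 (Ioi 0)) atTop := by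
  refine tendsto_atTop.mpr fun b => ?_
  obtain ⟨n, hn⟩ := exists_nat_ge b
  filter_upwards [Ioc_mem_nhdsGT (hs n)] with x hx
  have hx1 : x ≤ 1 := hx.2.trans (hs1 n)
  have h := le_logPotential ha hs hsum hx.1 hx1 n
  have h1 := ha n
  have h2 := hs n
  have e1 : 0 ≤ Real.log (1 + s n) := Real.log_nonneg (by linarith)
  have e2 : Real.log (s n + x) ≤ Real.log (2 * s n) :=
    Real.log_le_log (by linarith [hx.1]) (by linarith [hx.2])
  nlinarith [hlog n]

theorem surjOn_logPotential (ha : ∀ i, 0 < a i) (hs : ∀ i, 0 < s i) (hs1 : ∀ i, s i ≤ 1)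
    (hsum : Summable a) (hlog : ∀ n : ℕ, 2 * n ≤ a n * - Real.log (2 * s n)) :
    Function.Surjective fun τ => logPotential a s (Real.exp (-τ)) := by
  have hcont : Continuous fun τ => logPotential a s (Real.exp (-τ)) :=
    (contDiffOn_logPotential ha hs hsum).continuousOn.comp_continuous (by fun_prop)
      fun τ => Real.exp_pos _
  refine hcont.surjective ?_ ?_
  · refine (tendsto_logPotential_zero ha hs hs1 hsum hlog).comp
      (tendsto_nhdsWithin_iff.mpr ⟨?_, Eventually.of_forall fun τ => Real.exp_pos _⟩)
    exact Real.tendsto_exp_atBot.comp tendsto_neg_atTop_atBot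
  · exact (tendsto_logPotential_atTop ha hs hsum).comp
      (Real.tendsto_exp_atTop.comp tendsto_neg_atBot_atTop)

/-- Every smooth function on `(0, ∞)` is a smooth function of the logarithmic potential. -/
theorem exists_contDiff_comp_logPotential (ha : ∀ i, 0 < a i) (hs : ∀ i, 0 < s i)
    (hs1 : ∀ i, s i ≤ 1) (hsum : Summable a)
    (hlog : ∀ n : ℕ, 2 * n ≤ a n * - Real.log (2 * s n)) {F : ℝ → ℝ}
    (hF : ContDiffOn ℝ (⊤ : ℕ∞) F (Ioi 0)) :
    ∃ f : ℝ → ℝ, ContDiff ℝ (⊤ : ℕ∞) f ∧ ∀ x, 0 < x → f (logPotential a s x) = F x := by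
  have hexp : ContDiff ℝ (⊤ : ℕ∞) fun τ : ℝ => Real.exp (-τ) := by fun_prop
  have hmono : StrictMono fun τ => logPotential a s (Real.exp (-τ)) := fun τ σ h =>
    strictAntiOn_logPotential ha hs hsum (Real.exp_pos _) (Real.exp_pos _)
      (Real.exp_lt_exp.mpr (neg_lt_neg h))
  set e := (hmono.orderIsoOfSurjective _
    (surjOn_logPotential ha hs hs1 hsum hlog)).toHomeomorph with he
  have hcoe : ∀ τ, e τ = logPotential a s (Real.exp (-τ)) := fun τ => rfl
  have hsymm : ContDiff ℝ (⊤ : ℕ∞) e.symm := by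
    refine e.contDiff_symm_deriv
      (f' := fun τ => -1 / 2 * stieltjesMoment a s 1 (Real.exp (-τ)) * (Real.exp (-τ) * -1))
      (fun τ => ?_) (fun τ => ?_) ?_
    · have := stieltjesMoment_pos ha hs hsum 1 (Real.exp_pos (-τ))
      have := Real.exp_pos (-τ)
      have : 0 < stieltjesMoment a s 1 (Real.exp (-τ)) * Real.exp (-τ) := by positivity
      nlinarith
    · exact HasDerivAt.comp (h₂ := logPotential a s) (h := fun τ => Real.exp (-τ)) τ
        (hasDerivAt_logPotential ha hs hsum (Real.exp_pos (-τ))) (hasDerivAt_neg τ).exp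
    · exact (contDiffOn_logPotential ha hs hsum).comp_contDiff hexp fun τ => Real.exp_pos _
  refine ⟨fun t => F (Real.exp (-e.symm t)),
    (hF.comp_contDiff hexp fun τ => Real.exp_pos _).comp hsymm, fun x hx => ?_⟩
  have h1 : logPotential a s x = e (-Real.log x) := by rw [hcoe, neg_neg, Real.exp_log hx]
  simp only [h1, e.symm_apply_apply, neg_neg, Real.exp_log hx]

/-- The function of `x = r²` that equals `-Δu` when `u` is the logarithmic potential at `r²`. -/
noncomputable def profileLaplacian (a s : ℕ → ℝ) (N x : ℝ) : ℝ :=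
  N * stieltjesMoment a s 1 x - 2 * x * stieltjesMoment a s 2 x

/-- The derivative of the Laplacian of the profile with respect to the profile. -/
noncomputable def profileSlope (a s : ℕ → ℝ) (N x : ℝ) : ℝ :=
  (2 * (N + 2) * stieltjesMoment a s 2 x - 8 * x * stieltjesMoment a s 3 x)
    / stieltjesMoment a s 1 x

theorem contDiffOn_profileLaplacian (ha : ∀ i, 0 < a i) (hs : ∀ i, 0 < s i) (hsum : Summable a)
    (N : ℝ) : ContDiffOn ℝ (⊤ : ℕ∞) (profileLaplacian a s N) (Ioi 0) :=
  (contDiffOn_const.mul (contDiffOn_stieltjesMoment ha hs hsum 1)).sub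
    ((contDiffOn_const.mul contDiffOn_id).mul (contDiffOn_stieltjesMoment ha hs hsum 2))

theorem le_profileLaplacian (ha : ∀ i, 0 < a i) (hs : ∀ i, 0 < s i) (hsum : Summable a)
    (N : ℝ) {x : ℝ} (hx : 0 < x) :
    (N - 2) * stieltjesMoment a s 1 x ≤ profileLaplacian a s N x := by
  have := mul_stieltjesMoment_succ_le ha hs hsum 1 hx
  unfold profileLaplacian
  norm_num at this
  linarith

theorem hasDerivAt_profileLaplacian (ha : ∀ i, 0 < a i) (hs : ∀ i, 0 < s i) (hsum : Summable a)
    (N : ℝ) {x : ℝ} (hx : 0 < x) :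
    HasDerivAt (profileLaplacian a s N)
      (-(N + 2) * stieltjesMoment a s 2 x + 4 * x * stieltjesMoment a s 3 x) x := by
  have h := ((hasDerivAt_stieltjesMoment ha hs hsum 1 hx).const_mul N).sub
    (((hasDerivAt_id x).const_mul 2).mul (hasDerivAt_stieltjesMoment ha hs hsum 2 hx))
  refine h.congr_deriv ?_
  simp only [id]
  norm_num
  ring

theorem deriv_eq_profileSlope (ha : ∀ i, 0 < a i) (hs : ∀ i, 0 < s i) (hsum : Summable a)
    {N : ℝ} {f : ℝ → ℝ} (hf : Differentiable ℝ f)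
    (hfF : ∀ x, 0 < x → f (logPotential a s x) = profileLaplacian a s N x) {x : ℝ} (hx : 0 < x) :
    deriv f (logPotential a s x) = profileSlope a s N x := by
  have h1 := (hf (logPotential a s x)).hasDerivAt.comp x (hasDerivAt_logPotential ha hs hsum hx)
  have h2 : f ∘ logPotential a s =ᶠ[nhds x] profileLaplacian a s N := by
    filter_upwards [Ioi_mem_nhds hx] with y hy using hfF y hy
  have h3 := (h1.congr_of_eventuallyEq h2.symm).unique (hasDerivAt_profileLaplacian ha hs hsum N hx)
  have hpos := stieltjesMoment_pos ha hs hsum 1 hx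
  unfold profileSlope
  rw [eq_div_iff hpos.ne']
  linarith

theorem profileSlope_nonneg (ha : ∀ i, 0 < a i) (hs : ∀ i, 0 < s i) (hsum : Summable a)
    {N : ℝ} (hN : 2 ≤ N) {x : ℝ} (hx : 0 < x) : 0 ≤ profileSlope a s N x := by
  have h1 := stieltjesMoment_pos ha hs hsum 1 hx
  have h2 := stieltjesMoment_pos ha hs hsum 2 hx
  have h3 := mul_stieltjesMoment_succ_le ha hs hsum 2 hx
  norm_num at h3
  refine div_nonneg ?_ h1.le
  nlinarith

theorem profileSlope_le (ha : ∀ i, 0 < a i) (hs : ∀ i, 0 < s i) (hsum : Summable a)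
    {N : ℝ} (hN : 6 ≤ N) {x : ℝ} (hx : 0 < x) : profileSlope a s N x ≤ 2 * (N - 2) / x := by
  have S := fun k => (summable_stieltjesMoment ha hs hsum k hx).hasSum
  have h1 := stieltjesMoment_pos ha hs hsum 1 hx
  unfold profileSlope
  rw [div_le_div_iff₀ h1 hx, ← sub_nonneg]
  refine (((S 1).mul_left (2 * (N - 2))).sub
    ((((S 2).mul_left (2 * (N + 2))).sub ((S 3).mul_left (8 * x))).mul_right x)).nonneg fun i => ?_
  have h1 := ha i
  have h2 := hs i
  have h3 : 0 < s i + x := by positivity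
  have e : 2 * (N - 2) * (a i / (s i + x) ^ 1) - (2 * (N + 2) * (a i / (s i + x) ^ 2)
      - 8 * x * (a i / (s i + x) ^ 3)) * x
      = a i * (2 * (N - 2) * s i ^ 2 + 2 * (N - 6) * (s i * x)) / (s i + x) ^ 3 := by
    field_simp
    ring
  rw [e]
  have : 0 ≤ N - 6 := by linarith
  have : 0 ≤ N - 2 := by linarith
  positivity

theorem antitoneOn_profileSlope (ha : ∀ i, 0 < a i) (hs : ∀ i, 0 < s i) (hsum : Summable a)
    {N : ℝ} (hN : 6 ≤ N) : AntitoneOn (profileSlope a s N) (Ioi 0) := by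
  have hd : ∀ x ∈ Ioi (0 : ℝ), HasDerivAt (profileSlope a s N) _ x := fun x hx =>
    ((((hasDerivAt_stieltjesMoment ha hs hsum 2 hx).const_mul (2 * (N + 2))).sub
      (((hasDerivAt_id x).const_mul 8).mul (hasDerivAt_stieltjesMoment ha hs hsum 3 hx))).div
      (hasDerivAt_stieltjesMoment ha hs hsum 1 hx) (stieltjesMoment_pos ha hs hsum 1 hx).ne')
  refine antitoneOn_of_deriv_nonpos (convex_Ioi 0)
    (fun x hx => (hd x hx).continuousAt.continuousWithinAt) ?_ ?_ <;> rw [interior_Ioi]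
  · exact fun x hx => (hd x hx).differentiableAt.differentiableWithinAt
  intro x hx
  rw [(hd x hx).deriv]
  refine div_nonpos_of_nonpos_of_nonneg ?_ (sq_nonneg _)
  have hx0 : 0 < x := hx
  have p1 := stieltjesMoment_pos ha hs hsum 1 hx
  have p2 := stieltjesMoment_pos ha hs hsum 2 hx
  have p3 := stieltjesMoment_pos ha hs hsum 3 hx
  have cs := stieltjesMoment_two_sq_le ha hs hsum hx
  have h4 := mul_stieltjesMoment_succ_le ha hs hsum 3 hx
  simp only [id, Pi.sub_apply, Pi.mul_apply]
  norm_num at h4 ⊢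
  have m1 := mul_le_mul_of_nonneg_left h4 p1.le
  have m2 : 0 ≤ x * stieltjesMoment a s 3 x * stieltjesMoment a s 2 x := by positivity
  have m3 := mul_le_mul_of_nonneg_left cs (by linarith : 0 ≤ 2 * (N + 2))
  have m4 : 0 ≤ (N - 6) * (stieltjesMoment a s 1 x * stieltjesMoment a s 3 x) :=
    mul_nonneg (by linarith) (by positivity)
  nlinarith

/-- The nonlinearity generated by a logarithmic potential satisfies `StarCond`. -/
theorem starCond_of_comp_logPotential (ha : ∀ i, 0 < a i) (hs : ∀ i, 0 < s i)
    (hs1 : ∀ i, s i ≤ 1) (hsum : Summable a)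
    (hlog : ∀ n : ℕ, 2 * n ≤ a n * - Real.log (2 * s n)) {N : ℝ} (hN : 6 ≤ N) {f : ℝ → ℝ}
    (hf : ContDiff ℝ (⊤ : ℕ∞) f)
    (hfF : ∀ x, 0 < x → f (logPotential a s x) = profileLaplacian a s N x) : StarCond f := by
  have hfd : Differentiable ℝ f := hf.differentiable (by simp)
  have hsurj : ∀ t, ∃ x, 0 < x ∧ logPotential a s x = t := fun t =>
    (surjOn_logPotential ha hs hs1 hsum hlog t).imp' _ fun τ h => ⟨Real.exp_pos (-τ), h⟩
  have hderiv := fun {x} hx => deriv_eq_profileSlope ha hs hsum hfd hfF (x := x) hx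
  have hnonneg : ∀ t, 0 ≤ deriv f t := fun t => by
    obtain ⟨x, hx, rfl⟩ := hsurj t
    rw [hderiv hx]
    exact profileSlope_nonneg ha hs hsum (by linarith) hx
  have hmono : Monotone (deriv f) := fun t t' h => by
    obtain ⟨x, hx, rfl⟩ := hsurj t
    obtain ⟨y, hy, rfl⟩ := hsurj t'
    rw [hderiv hx, hderiv hy]
    exact antitoneOn_profileSlope ha hs hsum hN hy hx
      ((strictAntiOn_logPotential ha hs hsum).le_iff_ge hx hy |>.mp h)
  refine ⟨(hf.of_le (by exact_mod_cast le_top)).contDiffOn,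
    (monotone_of_deriv_nonneg hfd hnonneg).monotoneOn _,
    (hmono.convexOn_univ_of_deriv hfd).subset (subset_univ _) (convex_Ici 0), ?_, ?_⟩
  · have h0 := hfF 1 one_pos
    rw [logPotential_one] at h0
    rw [h0]
    exact lt_of_lt_of_le (mul_pos (by linarith) (stieltjesMoment_pos ha hs hsum 1 one_pos))
      (le_profileLaplacian ha hs hsum N one_pos)
  · refine tendsto_atTop.mpr fun b => ?_
    have hK : 0 < |b| + 1 := by positivity
    have hA : 0 < ∑' i, a i := hsum.tsum_pos (fun i => (ha i).le) 0 (ha 0)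
    filter_upwards [eventually_ge_atTop ((|b| + 1) ^ 2 * ∑' i, a i), eventually_gt_atTop 0]
      with t ht ht0
    obtain ⟨x, hx, rfl⟩ := hsurj t
    rw [le_div_iff₀ ht0, hfF x hx]
    have h1 := le_profileLaplacian ha hs hsum N hx
    have h2 := mul_logPotential_le ha hs hs1 hsum hx hK
    have h3 := stieltjesMoment_pos ha hs hsum 1 hx
    nlinarith [le_abs_self b]

theorem stieltjesMoment_le_sum_add (ha : ∀ i, 0 < a i) (hs : ∀ i, 0 < s i) (hsum : Summable a)
    (k n : ℕ) {x : ℝ} (hx : 0 < x) :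
    stieltjesMoment a s k x
      ≤ ∑ i ∈ Finset.range n, a i / s i ^ k + (∑' i, a (i + n)) / x ^ k := by
  unfold stieltjesMoment
  rw [← (summable_stieltjesMoment ha hs hsum k hx).sum_add_tsum_nat_add n, ← tsum_div_const]
  refine add_le_add (Finset.sum_le_sum fun i _ => ?_) (Summable.tsum_le_tsum
    (fun i => div_add_pow_le ha hs k hx le_rfl _)
    ((summable_nat_add_iff n).mpr (summable_stieltjesMoment ha hs hsum k hx))
    (((summable_nat_add_iff n).mpr hsum).div_const _))
  have h1 := ha i
  have h2 := hs i
  gcongr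
  linarith

theorem div_two_le_stieltjesMoment_one (ha : ∀ i, 0 < a i) (hs : ∀ i, 0 < s i)
    (hs1 : ∀ i, s i ≤ 1) (hsum : Summable a) {x : ℝ} (hx : 0 < x) (hx1 : x ≤ 1) (n : ℕ) :
    a n / 2 ≤ stieltjesMoment a s 1 x := by
  refine le_trans ?_ ((summable_stieltjesMoment ha hs hsum 1 hx).le_tsum n fun i _ => ?_)
  · have h1 := ha n
    have h2 := hs n
    rw [pow_one]
    gcongr
    linarith [hs1 n]
  · have h1 := ha i
    have h2 := hs i
    positivity

theorem profileSlope_le_of_tail (ha : ∀ i, 0 < a i) (hs : ∀ i, 0 < s i)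
    (hs1 : ∀ i, s i ≤ 1) (hsum : Summable a) {N : ℝ} (hN : 0 ≤ N) {x : ℝ} (hx : 0 < x)
    (hx1 : x ≤ 1) {n : ℕ} (htail : ∑' i, a (i + n) ≤ x ^ 2) :
    profileSlope a s N x
      ≤ 4 * (N + 2) / a 0 * (∑ i ∈ Finset.range n, a i / s i ^ 2 + 1) := by
  have h0 := ha 0
  have h1 := div_two_le_stieltjesMoment_one ha hs hs1 hsum hx hx1 0
  have h2 := stieltjesMoment_le_sum_add ha hs hsum 2 n hx
  have h3 := stieltjesMoment_pos ha hs hsum 3 hx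
  have h4 : (∑' i, a (i + n)) / x ^ 2 ≤ 1 := div_le_one_of_le₀ htail (by positivity)
  have h5 := stieltjesMoment_pos ha hs hsum 2 hx
  unfold profileSlope
  calc _ ≤ (2 * (N + 2) * stieltjesMoment a s 2 x) / stieltjesMoment a s 1 x := by
        gcongr
        · linarith
        · have : 0 < 8 * x * stieltjesMoment a s 3 x := by positivity
          linarith
    _ ≤ (2 * (N + 2) * (∑ i ∈ Finset.range n, a i / s i ^ 2 + 1)) / (a 0 / 2) := by
        have : stieltjesMoment a s 2 x ≤ ∑ i ∈ Finset.range n, a i / s i ^ 2 + 1 := by linarith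
        have : 0 ≤ ∑ i ∈ Finset.range n, a i / s i ^ 2 + 1 := by linarith
        gcongr
    _ = _ := by
        field_simp
        ring

end Moments

/-- Weights, nodes and radii for which the first `n + 1` atoms control the profile at radius `r n`,
while the profile is unbounded. -/
theorem exists_weights_nodes_radii {φ : ℝ → ℝ}
    (hφlim : Tendsto φ (nhdsWithin 0 (Set.Ioi 0)) atTop) :
    ∃ a s r : ℕ → ℝ, (∀ i, 0 < a i) ∧ (∀ i, 0 < s i) ∧ (∀ i, s i ≤ 1) ∧ Summable a ∧
      (∀ n : ℕ, 2 * n ≤ a n * - Real.log (2 * s n)) ∧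
      (∀ n, 0 < r n) ∧ (∀ n : ℕ, r n ≤ 1 / (n + 1)) ∧
      (∀ n : ℕ, (n + 1) * (∑ i ∈ Finset.range (n + 1), a i / s i ^ 2 + 1) ≤ φ (r n)) ∧
      ∀ n, ∑' i, a (i + (n + 1)) ≤ r n ^ 4 := by
  have hρ : ∀ (n : ℕ) (M : ℝ), ∃ r : ℝ, 0 < r ∧ r ≤ 1 / ((n : ℝ) + 1) ∧ M ≤ φ r := fun n M => by
    have h1 : Ioc (0 : ℝ) (1 / ((n : ℝ) + 1)) ∈ nhdsWithin 0 (Ioi 0) :=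
      Ioc_mem_nhdsGT (by positivity)
    obtain ⟨r, hr, hM⟩ := ((eventually_of_mem h1 fun _ h => h).and
      (hφlim.eventually_ge_atTop M)).exists
    exact ⟨r, hr.1, hr.2, hM⟩
  choose ρ hρ0 hρ1 hρφ using hρ
  let S : ℕ → ℝ → ℝ := fun n b => Real.exp (-(2 * n / b)) / 2
  let R : ℕ → ℝ × ℝ → ℝ := fun n p => ρ n ((n + 1) * (p.2 + 1))
  let A : ℕ → ℝ × ℝ → ℝ := fun n p => min p.1 (R n p ^ 4) / 2
  let P : ℕ → ℝ × ℝ := fun n => Nat.rec (1, 1 / S 0 1 ^ 2)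
    (fun n p => (A n p, p.2 + A n p / S (n + 1) (A n p) ^ 2)) n
  have hP1 : ∀ n, (P (n + 1)).1 = min (P n).1 (R n (P n) ^ 4) / 2 := fun n => rfl
  have hP2 : ∀ n, (P (n + 1)).2
      = (P n).2 + (P (n + 1)).1 / S (n + 1) (P (n + 1)).1 ^ 2 := fun n => rfl
  have hR0 : ∀ n, 0 < R n (P n) := fun n => hρ0 _ _
  have ha : ∀ n, 0 < (P n).1 := fun n => by
    induction n with
    | zero => exact one_pos
    | succ n ih =>
      rw [hP1]
      have := hR0 n
      positivity
  have hC : ∀ n, (P n).2 = ∑ i ∈ Finset.range (n + 1), (P i).1 / S i (P i).1 ^ 2 := fun n => by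
    induction n with
    | zero => simp [P]
    | succ n ih => rw [hP2, ih, Finset.sum_range_succ _ (n + 1)]
  have hhalf : ∀ n, (P (n + 1)).1 ≤ (P n).1 / 2 := fun n => by
    rw [hP1]
    gcongr
    exact min_le_left _ _
  have hgeom : ∀ n i, (P (i + n)).1 ≤ (P n).1 * (1 / 2) ^ i := fun n i => by
    induction i with
    | zero => simp
    | succ i ih =>
      have := hhalf (i + n)
      rw [show i + 1 + n = i + n + 1 by ring, pow_succ]
      linarith
  have hgs : Summable fun i : ℕ => (1 / 2 : ℝ) ^ i := summable_geometric_two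
  have hsum : Summable fun n => (P n).1 :=
    Summable.of_nonneg_of_le (fun n => (ha n).le) (fun n => hgeom 0 n) (hgs.mul_left _)
  refine ⟨fun n => (P n).1, fun n => S n (P n).1, fun n => R n (P n), ha,
    fun i => by positivity, fun i => ?_, hsum, fun n => ?_, hR0, fun n => hρ1 _ _, fun n => ?_,
    fun n => ?_⟩
  · have h1 : Real.exp (-(2 * i / (P i).1)) ≤ 1 := Real.exp_le_one_iff.mpr
      (neg_nonpos.mpr (div_nonneg (by positivity) (ha i).le))
    simp only [S]
    linarith
  · have := (ha n).ne'
    simp only [S]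
    rw [mul_div_cancel₀ _ two_ne_zero, Real.log_exp, neg_neg, mul_div_cancel₀ _ this]
  · rw [← hC]
    exact hρφ _ _
  · calc ∑' i, (P (i + (n + 1))).1 ≤ ∑' i : ℕ, (P (n + 1)).1 * (1 / 2) ^ i :=
          Summable.tsum_le_tsum (fun i => hgeom (n + 1) i) ((summable_nat_add_iff (n + 1)).mpr hsum)
            (hgs.mul_left _)
      _ = (P (n + 1)).1 * 2 := by rw [tsum_mul_left, tsum_geometric_two]
      _ ≤ R n (P n) ^ 4 := by
          rw [hP1]
          linarith [min_le_right (P n).1 (R n (P n) ^ 4)]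

theorem liminf_eq_zero_of_tendsto_comp {α ι : Type*} {l : Filter α} {p : Filter ι} [NeBot p]
    {g : α → ℝ} (hg : ∀ᶠ x in l, 0 ≤ g x) {r : ι → α} (hr : Tendsto r p l)
    (hgr : Tendsto (g ∘ r) p (nhds 0)) : liminf g l = 0 := by
  have hfreq : ∀ ε > 0, ∃ᶠ x in l, g x ≤ ε := fun ε hε =>
    hr.frequently ((hgr.eventually_le_const hε).frequently)
  have hbdd : IsBoundedUnder (· ≥ ·) l g := ⟨0, hg⟩
  refine le_antisymm (le_of_forall_pos_le_add fun ε hε => ?_) ?_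
  · rw [zero_add]
    exact liminf_le_of_frequently_le (hfreq ε hε) hbdd
  · exact le_liminf_of_le (IsCoboundedUnder.of_frequently_le (hfreq 1 one_pos)) hg

theorem stmt13 (N : ℕ) (hN : 10 ≤ N) (φ : ℝ → ℝ)
    (hφpos : ∀ r ∈ Set.Ioo (0:ℝ) 1, 0 < φ r)
    (hφlim : Tendsto φ (nhdsWithin 0 (Set.Ioi 0)) atTop) :
    ∃ f u u' u'' : ℝ → ℝ,
      ContDiffOn ℝ (⊤ : ℕ∞) f (Set.Ici 0) ∧ StarCond f ∧
      ContDiffOn ℝ (⊤ : ℕ∞) u (Set.Ioc 0 1) ∧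
      (∀ r ∈ Set.Ioc (0:ℝ) 1, HasDerivWithinAt u (u' r) (Set.Ioc 0 1) r) ∧
      (∀ r ∈ Set.Ioc (0:ℝ) 1, HasDerivWithinAt u' (u'' r) (Set.Ioc 0 1) r) ∧
      u 1 = 0 ∧
      (∀ r ∈ Set.Ioc (0:ℝ) 1, u' r < 0) ∧
      Tendsto u (nhdsWithin 0 (Set.Ioi 0)) atTop ∧
      IntervalIntegrable (fun r => r ^ (N - 1) * (u r ^ 2 + u' r ^ 2)) volume 0 1 ∧
      (∀ r ∈ Set.Ioc (0:ℝ) 1, -u'' r - ((N:ℝ) - 1) / r * u' r = f (u r)) ∧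
      (∀ r ∈ Set.Ioc (0:ℝ) 1,
        derivWithin f (Set.Ici 0) (u r) ≤ 2 * ((N:ℝ) - 2) / r ^ 2) ∧
      Filter.liminf (fun r => derivWithin f (Set.Ici 0) (u r) / φ r)
        (nhdsWithin 0 (Set.Ioi 0)) = 0 := by
  obtain ⟨a, s, R, ha, hs, hs1, hsum, hlog, hR0, hR1, hRφ, htail⟩ :=
    exists_weights_nodes_radii hφlim
  have hN' : (10 : ℝ) ≤ N := by exact_mod_cast hN
  obtain ⟨f, hf, hfF⟩ := exists_contDiff_comp_logPotential ha hs hs1 hsum hlog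
    (contDiffOn_profileLaplacian ha hs hsum N)
  have hfd : Differentiable ℝ f := hf.differentiable (by simp)
  have hu0 : ∀ r ∈ Ioc (0 : ℝ) 1, 0 ≤ logPotential a s (r ^ 2) := fun r hr => by
    rw [← logPotential_one (a := a) (s := s)]
    have h2 : r ^ 2 ≤ 1 := pow_le_one₀ hr.1.le hr.2
    exact (strictAntiOn_logPotential ha hs hsum).antitoneOn (pow_pos hr.1 2) (mem_Ioi.mpr one_pos) h2
  have hdw : ∀ r ∈ Ioc (0 : ℝ) 1, derivWithin f (Ici 0) (logPotential a s (r ^ 2))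
      = profileSlope a s N (r ^ 2) := fun r hr => by
    rw [(hfd _).derivWithin (uniqueDiffOn_Ici 0 _ (hu0 r hr)),
      deriv_eq_profileSlope ha hs hsum hfd hfF (pow_pos hr.1 2)]
  have hu' : ∀ r : ℝ, 0 < r → HasDerivAt (fun r => logPotential a s (r ^ 2))
      (-r * stieltjesMoment a s 1 (r ^ 2)) r := fun r hr => by
    refine (HasDerivAt.comp (h₂ := logPotential a s) (h := fun r => r ^ 2) r
      (hasDerivAt_logPotential ha hs hsum (pow_pos hr 2)) (hasDerivAt_pow 2 r)).congr_deriv ?_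
    norm_num
    ring
  have hu'' : ∀ r : ℝ, 0 < r → HasDerivAt (fun r => -r * stieltjesMoment a s 1 (r ^ 2))
      (-stieltjesMoment a s 1 (r ^ 2) + 2 * r ^ 2 * stieltjesMoment a s 2 (r ^ 2)) r :=
    fun r hr => by
    refine ((hasDerivAt_neg r).mul (HasDerivAt.comp (h₂ := stieltjesMoment a s 1)
      (h := fun r => r ^ 2) r (hasDerivAt_stieltjesMoment ha hs hsum 1 (pow_pos hr 2))
      (hasDerivAt_pow 2 r))).congr_deriv ?_
    simp only [Function.comp]
    norm_num
    ring
  have hlim0 : Tendsto (fun r : ℝ => r ^ 2) (nhdsWithin 0 (Ioi 0)) (nhdsWithin 0 (Ioi 0)) := by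
    refine tendsto_nhdsWithin_iff.mpr ⟨?_, ?_⟩
    · have : Tendsto (fun r : ℝ => r ^ 2) (nhds 0) (nhds (0 ^ 2)) := (continuous_pow 2).tendsto 0
      rw [zero_pow two_ne_zero] at this
      exact this.mono_left nhdsWithin_le_nhds
    · filter_upwards [self_mem_nhdsWithin] with r hr using pow_pos (mem_Ioi.mp hr) 2
  refine ⟨f, fun r => logPotential a s (r ^ 2), fun r => -r * stieltjesMoment a s 1 (r ^ 2),
    fun r => -stieltjesMoment a s 1 (r ^ 2) + 2 * r ^ 2 * stieltjesMoment a s 2 (r ^ 2),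
    hf.contDiffOn, starCond_of_comp_logPotential ha hs hs1 hsum hlog (by linarith) hf hfF,
    ?_, fun r hr => (hu' r hr.1).hasDerivWithinAt, fun r hr => (hu'' r hr.1).hasDerivWithinAt,
    ?_, fun r hr => ?_, ?_, ?_, fun r hr => ?_, fun r hr => ?_, ?_⟩
  · exact (contDiffOn_logPotential ha hs hsum).comp (contDiff_id.pow 2).contDiffOn
      fun r hr => pow_pos hr.1 2
  · simp only [one_pow, logPotential_one]
  · have := mul_pos hr.1 (stieltjesMoment_pos ha hs hsum 1 (pow_pos hr.1 2))
    linarith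
  · exact (tendsto_logPotential_zero ha hs hs1 hsum hlog).comp hlim0
  · rw [intervalIntegrable_iff_integrableOn_Ioc_of_le zero_le_one]
    refine IntegrableOn.of_bound (by simp) ?_ (5 * (∑' i, a i) ^ 2) ?_
    · refine ContinuousOn.aestronglyMeasurable (fun r hr => ?_) measurableSet_Ioc
      exact ((continuousAt_id.pow _).mul (((hu' r hr.1).continuousAt.pow 2).add
        ((hu'' r hr.1).continuousAt.pow 2))).continuousWithinAt
    · refine (ae_restrict_iff' measurableSet_Ioc).mpr (Eventually.of_forall fun r hr => ?_)
      obtain ⟨hr0, hr1⟩ := hr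
      have hA : 0 < ∑' i, a i := hsum.tsum_pos (fun i => (ha i).le) 0 (ha 0)
      set T := ∑' i, a i
      have hY := stieltjesMoment_le ha hs hsum 1 (pow_pos hr0 2)
      have hYp := stieltjesMoment_pos ha hs hsum 1 (pow_pos hr0 2)
      have hU := mul_logPotential_le ha hs hs1 hsum (pow_pos hr0 2) one_pos
      have hU0 := hu0 r ⟨hr0, hr1⟩
      rw [pow_one, le_div_iff₀ (pow_pos hr0 2)] at hY
      have hr2 : r ^ 2 ≤ 1 := pow_le_one₀ hr0.le hr1
      have h1 : r ^ 2 * logPotential a s (r ^ 2) ≤ 2 * T := by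
        have := mul_le_mul_of_nonneg_left hU (sq_nonneg r)
        have := mul_le_mul_of_nonneg_right hr2 hA.le
        linarith
      have h2 : r ^ 2 * (r * stieltjesMoment a s 1 (r ^ 2)) ≤ T := by
        have : r * (stieltjesMoment a s 1 (r ^ 2) * r ^ 2) ≤ 1 * T := by gcongr
        linarith
      have h3 : r ^ (N - 1) ≤ r ^ 4 := pow_le_pow_of_le_one hr0.le hr1 (by omega)
      rw [Real.norm_of_nonneg (by positivity)]
      calc _ ≤ r ^ 4 * (logPotential a s (r ^ 2) ^ 2
            + (-r * stieltjesMoment a s 1 (r ^ 2)) ^ 2) := by gcongr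
        _ = (r ^ 2 * logPotential a s (r ^ 2)) ^ 2
            + (r ^ 2 * (r * stieltjesMoment a s 1 (r ^ 2))) ^ 2 := by ring
        _ ≤ (2 * T) ^ 2 + T ^ 2 := by gcongr
        _ = 5 * T ^ 2 := by ring
  · rw [hfF _ (pow_pos hr.1 2)]
    have := hr.1.ne'
    unfold profileLaplacian
    field_simp
    ring
  · rw [hdw r hr]
    exact profileSlope_le ha hs hsum (by linarith) (pow_pos hr.1 2)
  · have hRmem : ∀ n, R n ∈ Ioc (0 : ℝ) 1 := fun n =>
      ⟨hR0 n, (hR1 n).trans (div_le_one_of_le₀ (by linarith [n.cast_nonneg (α := ℝ)])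
        (by positivity))⟩
    have hRlim : Tendsto R atTop (nhdsWithin 0 (Ioi 0)) :=
      tendsto_nhdsWithin_iff.mpr ⟨squeeze_zero (fun n => (hR0 n).le) hR1
        tendsto_one_div_add_atTop_nhds_zero_nat, Eventually.of_forall hR0⟩
    have hslope : ∀ r ∈ Ioc (0 : ℝ) 1, 0 ≤ profileSlope a s N (r ^ 2) := fun r hr =>
      profileSlope_nonneg ha hs hsum (by linarith) (pow_pos hr.1 2)
    refine liminf_eq_zero_of_tendsto_comp ?_ hRlim ?_
    · filter_upwards [Ioo_mem_nhdsGT (zero_lt_one' ℝ)] with r hr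
      rw [hdw r ⟨hr.1, hr.2.le⟩]
      exact div_nonneg (hslope r ⟨hr.1, hr.2.le⟩) (hφpos r hr).le
    · have hlim := (tendsto_one_div_add_atTop_nhds_zero_nat (𝕜 := ℝ)).const_mul
        (4 * ((N : ℝ) + 2) / a 0)
      rw [mul_zero] at hlim
      have hC : ∀ n, 0 < ∑ i ∈ Finset.range (n + 1), a i / s i ^ 2 + 1 := fun n =>
        add_pos_of_nonneg_of_pos (Finset.sum_nonneg fun i _ =>
          div_nonneg (ha i).le (sq_nonneg _)) one_pos
      have hφR : ∀ n, 0 < φ (R n) := fun n =>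
        lt_of_lt_of_le (mul_pos (by positivity) (hC n)) (hRφ n)
      refine squeeze_zero (fun n => ?_) (fun n => ?_) hlim <;>
        simp only [Function.comp_apply] <;> rw [hdw _ (hRmem n)]
      · exact div_nonneg (hslope _ (hRmem n)) (hφR n).le
      · have h1 := profileSlope_le_of_tail ha hs hs1 hsum (N := N) (by linarith)
          (pow_pos (hR0 n) 2) (pow_le_one₀ (hR0 n).le (hRmem n).2)
          ((htail n).trans_eq (by ring))
        rw [div_le_iff₀ (hφR n)]
        have hK : 0 < 4 * ((N : ℝ) + 2) / a 0 := div_pos (by positivity) (ha 0)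
        refine h1.trans ?_
        rw [mul_assoc]
        refine mul_le_mul_of_nonneg_left ?_ hK.le
        rw [one_div, ← div_eq_inv_mul, le_div_iff₀ (by positivity)]
        linarith [hRφ n]
end

section
/- Let N ≥ 10 be an integer and let C₁, C₂ be real numbers with 0 ≤ C₁ ≤ C₂ and 2(N−2) ≤ C₂ ≤ (N−2)²/4. Then there exist a C^∞ function f : [0,∞) → ℝ satisfying condition (★) and a C^∞ function u : (0,1] → ℝ such that: u(1) = 0; u'(r) < 0 for every r ∈ (0,1]; lim_{r→0⁺} u(r) = +∞; ∫₀¹ r^{N−1}(u(r)² + u'(r)²) dr < ∞; −u''(r) − ((N−1)/r)·u'(r) = f(u(r)) for every r ∈ (0,1]; f'(u(r)) ≤ (N−2)²/(4r²) for every r ∈ (0,1]; liminf_{r→0⁺} r²·f'(u(r)) = C₁; and limsup_{r→0⁺} r²·f'(u(r)) = C₂. -/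
open MeasureTheory Filter Set

open scoped Topology

lemma contDiff_deriv {f : ℝ → ℝ} (h : ContDiff ℝ (⊤ : ℕ∞) f) : ContDiff ℝ (⊤ : ℕ∞) (deriv f) :=
  (contDiff_infty_iff_deriv.mp h).2

lemma hasDerivAt_of_contDiff {f : ℝ → ℝ} (h : ContDiff ℝ (⊤ : ℕ∞) f) (x : ℝ) :
    HasDerivAt f (deriv f x) x :=
  ((contDiff_infty_iff_deriv.mp h).1 x).hasDerivAt

lemma sub_le_sub_of_hasDerivAt {f g f' g' : ℝ → ℝ} {a b : ℝ} (hab : a ≤ b)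
    (hf : ∀ x ∈ Icc a b, HasDerivAt f (f' x) x) (hg : ∀ x ∈ Icc a b, HasDerivAt g (g' x) x)
    (h : ∀ x ∈ Icc a b, f' x ≤ g' x) : f b - f a ≤ g b - g a := by
  have hm : MonotoneOn (fun x => g x - f x) (Icc a b) := by
    refine monotoneOn_of_deriv_nonneg (convex_Icc a b)
      (fun x hx => ((hg x hx).sub (hf x hx)).continuousAt.continuousWithinAt)
      (fun x hx => ((hg x (interior_subset hx)).sub
        (hf x (interior_subset hx))).differentiableAt.differentiableWithinAt) fun x hx => ?_
    have hx' := interior_subset hx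
    have := ((hg x hx').sub (hf x hx')).deriv
    change deriv (g - f) x ≥ 0
    rw [this]
    linarith [h x hx']
  have := hm (left_mem_Icc.2 hab) (right_mem_Icc.2 hab) hab
  simp only at this
  linarith

/-- A smooth bump with its first two derivatives bounded. -/
lemma exists_bump : ∃ φ : ℝ → ℝ, ∃ M : ℝ, 1 ≤ M ∧ ContDiff ℝ (⊤ : ℕ∞) φ ∧ φ 0 = 1 ∧
    (∀ x, 1 ≤ |x| → φ x = 0) ∧
    ∀ x, 0 ≤ φ x ∧ φ x ≤ 1 ∧ |deriv φ x| ≤ M ∧ |deriv (deriv φ) x| ≤ M := by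
  let φ : ContDiffBump (0 : ℝ) := ⟨1 / 2, 1, by norm_num, by norm_num⟩
  have hφ : ContDiff ℝ (⊤ : ℕ∞) φ := φ.contDiff
  have h1 := contDiff_deriv hφ
  obtain ⟨A, hA⟩ := h1.continuous.bounded_above_of_compact_support φ.hasCompactSupport.deriv
  obtain ⟨B, hB⟩ := (contDiff_deriv h1).continuous.bounded_above_of_compact_support
    φ.hasCompactSupport.deriv.deriv
  refine ⟨φ, max 1 (max A B), le_max_left _ _, hφ,
    φ.one_of_mem_closedBall (Metric.mem_closedBall_self (by norm_num [φ])), fun x hx => ?_,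
    fun x => ⟨φ.nonneg, φ.le_one, ?_, ?_⟩⟩
  · exact φ.zero_of_le_dist (by simpa [φ, Real.dist_eq] using hx)
  · exact (hA x).trans ((le_max_left _ _).trans (le_max_right _ _))
  · exact (hB x).trans ((le_max_right _ _).trans (le_max_right _ _))

/-- Sparse sums of unit bumps: the bound `M` on the derivatives does not depend on how long the
prescribed gaps are. -/
lemma exists_sparse : ∃ M : ℝ, 1 ≤ M ∧ ∀ E : ℝ → ℝ, ∃ g : ℝ → ℝ, ContDiff ℝ (⊤ : ℕ∞) g ∧
    (∀ x, 0 ≤ g x ∧ g x ≤ 1 ∧ |deriv g x| ≤ M ∧ |deriv (deriv g) x| ≤ M) ∧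
    (∀ X, ∃ x, X ≤ x ∧ g x = 1) ∧ ∀ X, ∃ x, X ≤ x ∧ ∀ y ∈ Icc x (E x), g y = 0 := by
  obtain ⟨φ, M, hM, hφ, hφ0, hφs, hφb⟩ := exists_bump
  refine ⟨M, hM, fun E => ?_⟩
  let c : ℕ → ℝ := fun n => Nat.rec 0 (fun _ y => y + 3 + |E (y + 1)|) n
  have hc (n : ℕ) : c (n + 1) = c n + 3 + |E (c n + 1)| := rfl
  have hstep (n : ℕ) : c n + 3 ≤ c (n + 1) := by rw [hc]; linarith [abs_nonneg (E (c n + 1))]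
  have hmono : Monotone c := monotone_nat_of_le_succ fun n => by linarith [hstep n]
  have hsep {m n : ℕ} (h : m < n) : c m + 3 ≤ c n := (hstep m).trans (hmono h)
  have hlow (n : ℕ) : (n : ℝ) ≤ c n := by
    induction n with
    | zero => simp [c]
    | succ n ih => push_cast; linarith [hstep n]
  classical
  let g : ℝ → ℝ := fun x => if h : ∃ n, |x - c n| < 3 / 2 then φ (x - c h.choose) else 0
  have hg (n : ℕ) (x : ℝ) (hx : |x - c n| < 3 / 2) : g x = φ (x - c n) := by
    have h : ∃ n, |x - c n| < 3 / 2 := ⟨n, hx⟩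
    have h2 := h.choose_spec
    have : h.choose = n := by
      rw [abs_lt] at hx h2
      rcases lt_trichotomy h.choose n with h3 | h3 | h3
      · linarith [hsep h3]
      · exact h3
      · linarith [hsep h3]
    simp only [g, dif_pos h, this]
  have hg0 (x : ℝ) (hx : ∀ n, 1 ≤ |x - c n|) : g x = 0 := by
    by_cases h : ∃ n, |x - c n| < 3 / 2
    · obtain ⟨n, hn⟩ := h
      rw [hg n x hn, hφs _ (hx n)]
    · simp only [g, dif_neg h]
  have hloc (x : ℝ) : ∃ y, g =ᶠ[𝓝 x] fun z => φ (z - y) := by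
    by_cases h : ∃ n, |x - c n| < 3 / 2
    · obtain ⟨n, hn⟩ := h
      refine ⟨c n, ?_⟩
      have : ∀ᶠ z in 𝓝 x, |z - c n| < 3 / 2 :=
        (by fun_prop : Continuous fun z => |z - c n|).continuousAt.eventually_lt_const hn
      filter_upwards [this] with z hz using hg n z hz
    · push Not at h
      refine ⟨x + 5, ?_⟩
      filter_upwards [Metric.ball_mem_nhds x (show (0 : ℝ) < 1 / 2 by norm_num)] with z hz
      rw [Metric.mem_ball, Real.dist_eq] at hz
      rw [hg0, hφs]
      · rw [abs_lt] at hz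
        rw [le_abs]; right; linarith
      · intro n
        have h1 := h n
        have h2 := abs_sub_abs_le_abs_sub (x - c n) (z - c n)
        rw [show x - c n - (z - c n) = -(z - x) by ring, abs_neg] at h2
        linarith
  refine ⟨g, ?_, fun x => ?_, fun X => ?_, fun X => ?_⟩
  · rw [contDiff_iff_contDiffAt]
    intro x
    obtain ⟨y, hy⟩ := hloc x
    exact ((hφ.comp (contDiff_id.sub contDiff_const)).contDiffAt).congr_of_eventuallyEq hy
  · obtain ⟨y, hy⟩ := hloc x
    have h1 : deriv g =ᶠ[𝓝 x] fun z => deriv φ (z - y) := by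
      filter_upwards [hy.deriv] with z hz
      rw [hz, deriv_comp_sub_const]
    have h2 : deriv (deriv g) x = deriv (deriv φ) (x - y) := by
      rw [h1.deriv_eq, deriv_comp_sub_const]
    rw [hy.eq_of_nhds, h1.eq_of_nhds, h2]
    exact hφb _
  · obtain ⟨n, hn⟩ := exists_nat_ge X
    refine ⟨c n, hn.trans (hlow n), ?_⟩
    rw [hg n _ (by norm_num), sub_self, hφ0]
  · obtain ⟨n, hn⟩ := exists_nat_ge X
    refine ⟨c n + 1, by linarith [hlow n], fun y hy => hg0 y fun m => ?_⟩
    rw [le_abs]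
    rcases le_or_gt m n with h | h
    · left; linarith [hy.1, hmono h]
    · right
      have := hmono (Nat.succ_le_of_lt h)
      rw [Nat.succ_eq_add_one, hc] at this
      linarith [hy.2, le_abs_self (E (c n + 1)), hlow n, n.cast_nonneg (α := ℝ)]

/-- The smooth scale `L t = log √(100 + t²)`, with `h = exp (-L)` and a right inverse `T` of `L`. -/
lemma exists_log_scale : ∃ L h L1 L2 T : ℝ → ℝ, ContDiff ℝ (⊤ : ℕ∞) L ∧ ContDiff ℝ (⊤ : ℕ∞) h ∧
    (∀ t, HasDerivAt L (L1 t) t) ∧ (∀ t, HasDerivAt h (-(L1 t) * h t) t) ∧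
    (∀ t, HasDerivAt L1 (L2 t) t) ∧
    (∀ t, 0 < h t ∧ h t ≤ 1 / 10 ∧ |t| * h t ≤ 1 ∧ |L1 t| ≤ h t ∧ |L2 t| ≤ h t ^ 2) ∧
    MonotoneOn L (Ici 0) ∧ ∀ X x, L X ≤ x → 0 ≤ T x ∧ X ≤ T x ∧ L (T x) = x := by
  let L : ℝ → ℝ := fun t => 1 / 2 * Real.log (100 + t ^ 2)
  have hq (t : ℝ) : 0 < 100 + t ^ 2 := by positivity
  let T : ℝ → ℝ := fun x => √(Real.exp (2 * x) - 100)
  have hLmono : MonotoneOn L (Ici 0) := by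
    intro a (ha : 0 ≤ a) b _ hab
    have := Real.log_le_log (hq a) (show 100 + a ^ 2 ≤ 100 + b ^ 2 by gcongr)
    simp only [L]; linarith
  have hT (X x : ℝ) (hx : L X ≤ x) : 0 ≤ T x ∧ X ≤ T x ∧ L (T x) = x := by
    have h1 : Real.log (100 + X ^ 2) ≤ 2 * x := by
      simp only [L] at hx; linarith
    rw [Real.log_le_iff_le_exp (hq X)] at h1
    refine ⟨Real.sqrt_nonneg _, Real.le_sqrt_of_sq_le (by linarith), ?_⟩
    simp only [L, T]
    rw [Real.sq_sqrt (by nlinarith [sq_nonneg X]), add_sub_cancel, Real.log_exp]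
    ring
  let h : ℝ → ℝ := fun t => Real.exp (-L t)
  have hh0 (t : ℝ) : 0 < h t := Real.exp_pos _
  have hhsq (t : ℝ) : h t ^ 2 = (100 + t ^ 2)⁻¹ := by
    simp only [h, L]
    rw [← Real.exp_nat_mul, ← Real.exp_log (hq t), ← Real.exp_neg, Real.log_exp]
    congr 1; push_cast; ring
  have hhsq' (t : ℝ) : h t ^ 2 * (100 + t ^ 2) = 1 := by
    rw [hhsq, inv_mul_cancel₀ (hq t).ne']
  have hh1 (t : ℝ) : h t ≤ 1 / 10 := by
    nlinarith [hhsq' t, hh0 t, mul_nonneg (sq_nonneg (h t)) (sq_nonneg t)]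
  have hth (t : ℝ) : |t| * h t ≤ 1 := by
    rw [← abs_one, ← abs_of_pos (hh0 t), ← abs_mul, ← sq_le_sq, mul_pow]
    nlinarith [hhsq' t, sq_nonneg (h t)]
  let L1 : ℝ → ℝ := fun t => t * h t ^ 2
  let L2 : ℝ → ℝ := fun t => (100 - t ^ 2) * h t ^ 4
  have hL (t : ℝ) : HasDerivAt L (L1 t) t := by
    have := (((hasDerivAt_pow 2 t).const_add 100).log (hq t).ne').const_mul (1 / 2)
    refine HasDerivAt.congr_deriv (f := L) this ?_
    simp only [L1, hhsq, Nat.cast_ofNat, Nat.add_one_sub_one, pow_one]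
    field_simp
  have hh (t : ℝ) : HasDerivAt h (-(L1 t) * h t) t := by
    have := (hL t).neg.exp
    exact HasDerivAt.congr_deriv (f := h) this (mul_comm _ _)
  have hL1 (t : ℝ) : HasDerivAt L1 (L2 t) t := by
    have := (hasDerivAt_id t).mul ((hh t).pow 2)
    refine HasDerivAt.congr_deriv (f := L1) this ?_
    simp only [L1, L2, id, Pi.pow_apply, Nat.cast_ofNat]
    linear_combination -(h t ^ 2) * hhsq' t
  have hL1b (t : ℝ) : |L1 t| ≤ h t := by
    simp only [L1]
    rw [abs_mul, abs_of_pos (pow_pos (hh0 t) 2)]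
    nlinarith [hth t, hh0 t]
  have hL2b (t : ℝ) : |L2 t| ≤ h t ^ 2 := by
    simp only [L2]
    rw [abs_mul, abs_of_pos (pow_pos (hh0 t) 4)]
    have h1 : |100 - t ^ 2| ≤ 100 + t ^ 2 := by
      rw [abs_le]; constructor <;> nlinarith [sq_nonneg t]
    calc |100 - t ^ 2| * h t ^ 4 ≤ (100 + t ^ 2) * h t ^ 4 := by gcongr
      _ = h t ^ 2 := by linear_combination h t ^ 2 * hhsq' t
  have hLs : ContDiff ℝ (⊤ : ℕ∞) L :=
    contDiff_const.mul ((contDiff_const.add (contDiff_id.pow 2)).log fun t => (hq t).ne')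
  exact ⟨L, h, L1, L2, T, hLs, hLs.neg.exp, hL, hh, hL1,
    fun t => ⟨hh0 t, hh1 t, hth t, hL1b t, hL2b t⟩, hLmono, hT⟩

/-- The slowly varying profile `k`, oscillating between `η` and `D - η` for a nonnegative function
`η` tending to zero, and equal to `η` on arbitrarily late intervals of prescribed length. -/
lemma exists_slow (D : ℝ) (hD : 0 ≤ D) (S : ℝ → ℝ) : ∃ k η : ℝ → ℝ,
    ContDiff ℝ (⊤ : ℕ∞) k ∧
    (∀ t, 0 ≤ η t ∧ η t ≤ 1 ∧ t * η t ≤ 1 ∧ η t ≤ k t ∧ k t ≤ D - η t ∧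
      |deriv k t| ≤ η t ∧ |deriv (deriv k) t| ≤ η t) ∧
    Tendsto η atTop (𝓝 0) ∧
    (∀ X, ∃ t, X ≤ t ∧ k t = D - η t) ∧
    ∀ X, ∃ t, X ≤ t ∧ ∀ y ∈ Icc t (S t), k y = η y := by
  obtain ⟨M, hM, hsp⟩ := exists_sparse
  set d : ℝ := D / (1 + D) with hd
  set ε : ℝ := 1 / (2 * M * (1 + D)) with hε
  have hε0 : 0 < ε := by positivity
  have hd0 : 0 ≤ d := by positivity
  have hd1 : d ≤ 1 := by rw [hd, div_le_one (by positivity)]; linarith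
  have hdD : d ≤ D := div_le_self hD (by linarith)
  have hDε : D * ε * M = d / 2 := by rw [hd, hε]; field_simp
  have hεM : ε * M ≤ 1 / 2 := by
    rw [hε, div_mul_eq_mul_div, div_le_iff₀ (by positivity)]
    nlinarith
  have hε1 : ε ≤ 1 := by nlinarith
  obtain ⟨L, h, L1, L2, T, hLs, hhs, hL, hh, hL1, hb, hLmono, hT⟩ := exists_log_scale
  obtain ⟨g, hg, hgb, hg1, hg0⟩ := hsp fun x => ε * L (S (T (x / ε)))
  have hT' (X x : ℝ) (hx : ε * L X ≤ x) : 0 ≤ T (x / ε) ∧ X ≤ T (x / ε) ∧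
      ε * L (T (x / ε)) = x := by
    obtain ⟨h0, h1, h2⟩ := hT X (x / ε) (by rw [le_div_iff₀ hε0]; linarith)
    exact ⟨h0, h1, by rw [h2]; field_simp⟩
  clear_value d ε
  let G : ℝ → ℝ := fun t => g (ε * L t)
  let G1 : ℝ → ℝ := fun t => deriv g (ε * L t)
  let G2 : ℝ → ℝ := fun t => deriv (deriv g) (ε * L t)
  have hG (t : ℝ) : HasDerivAt G (G1 t * (ε * L1 t)) t :=
    (hasDerivAt_of_contDiff hg _).comp t ((hL t).const_mul ε)
  have hG1 (t : ℝ) : HasDerivAt G1 (G2 t * (ε * L1 t)) t :=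
    (hasDerivAt_of_contDiff (contDiff_deriv hg) _).comp t ((hL t).const_mul ε)
  let k : ℝ → ℝ := fun t => d * h t + (D - 2 * (d * h t)) * G t
  let k1 : ℝ → ℝ := fun t => d * (-(L1 t) * h t) +
    ((-(2 * (d * (-(L1 t) * h t)))) * G t + (D - 2 * (d * h t)) * (G1 t * (ε * L1 t)))
  have hk (t : ℝ) : HasDerivAt k (k1 t) t :=
    ((hh t).const_mul d).add (((((hh t).const_mul d).const_mul 2).const_sub D).mul (hG t))
  have hk1 (t : ℝ) : HasDerivAt k1 (d * ((L1 t ^ 2 - L2 t) * h t) * (1 - 2 * G t)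
      + 4 * (d * (L1 t * h t) * (G1 t * (ε * L1 t)))
      + (D - 2 * (d * h t)) * (G2 t * (ε * L1 t) ^ 2 + G1 t * (ε * L2 t))) t := by
    have e1 := (((hL1 t).neg).mul (hh t)).const_mul d
    have e2 := (e1.const_mul 2).neg.mul (hG t)
    have e3 := ((((hh t).const_mul d).const_mul 2).const_sub D).mul
      ((hG1 t).mul ((hL1 t).const_mul ε))
    refine HasDerivAt.congr_deriv (f := k1) (e1.add (e2.add e3)) ?_
    simp only [Pi.neg_apply, Pi.mul_apply]
    ring
  have hdk : deriv k = k1 := funext fun t => (hk t).deriv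
  have hGb (t : ℝ) : |1 - 2 * G t| ≤ 1 := by
    have := hgb (ε * L t)
    rw [abs_le]; constructor <;> simp only [G] <;> linarith
  refine ⟨k, fun t => d * h t, (contDiff_const.mul hhs).add
    ((contDiff_const.sub (contDiff_const.mul (contDiff_const.mul hhs))).mul
      (hg.comp (contDiff_const.mul hLs))), fun t => ?_, ?_, fun X => ?_, fun X => ?_⟩
  · obtain ⟨b0, b1, bt, b6, b7⟩ := hb t
    have b2 := hgb (ε * L t)
    have b3 : 0 ≤ d * h t := by positivity
    have b4 : d * h t ≤ d * (1 / 10) := by gcongr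
    have b5 : 0 ≤ D - 2 * (d * h t) := by linarith
    have b8 := hGb t
    have b9 : |D - 2 * (d * h t)| ≤ D := by rw [abs_of_nonneg b5]; linarith
    have b10 : |G1 t| ≤ M := b2.2.2.1
    have b11 : |G2 t| ≤ M := b2.2.2.2
    have hM0 : 0 ≤ M := by linarith
    have hdh2 : d * h t ^ 2 ≤ d * h t / 10 := by nlinarith
    have hdh3 : d * h t ^ 3 ≤ d * h t / 100 := by
      have : h t ^ 2 ≤ 1 / 100 := by nlinarith
      nlinarith
    refine ⟨b3, by linarith, ?_, ?_, ?_, ?_, ?_⟩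
    · have : t * h t ≤ 1 := (mul_le_mul_of_nonneg_right (le_abs_self t) b0.le).trans bt
      nlinarith
    · change _ ≤ d * h t + (D - 2 * (d * h t)) * G t
      nlinarith [mul_nonneg b5 b2.1]
    · change d * h t + (D - 2 * (d * h t)) * G t ≤ _
      nlinarith [mul_le_mul_of_nonneg_left b2.2.1 b5]
    · rw [hdk, show k1 t = d * (-(L1 t) * h t) * (1 - 2 * G t) +
        (D - 2 * (d * h t)) * (G1 t * (ε * L1 t)) by simp only [k1]; ring]
      refine (abs_add_le _ _).trans ?_
      simp only [abs_mul, abs_neg]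
      rw [abs_of_nonneg hd0, abs_of_pos hε0, abs_of_pos b0]
      calc _ ≤ d * (h t * h t) * 1 + D * (M * (ε * h t)) := by gcongr
        _ = d * h t ^ 2 + D * ε * M * h t := by ring
        _ ≤ d * h t := by rw [hDε]; linarith
    · rw [hdk, (hk1 t).deriv]
      refine (abs_add_three _ _ _).trans ?_
      have b12 : |L1 t ^ 2 - L2 t| ≤ 2 * h t ^ 2 := by
        refine (abs_sub _ _).trans ?_
        rw [abs_pow]
        have : |L1 t| ^ 2 ≤ h t ^ 2 := by gcongr
        linarith
      have b13 : |G2 t * (ε * L1 t) ^ 2 + G1 t * (ε * L2 t)| ≤ 2 * (ε * M * h t ^ 2) := by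
        refine (abs_add_le _ _).trans ?_
        simp only [abs_mul, abs_pow]
        rw [abs_of_pos hε0]
        calc _ ≤ M * (ε * h t) ^ 2 + M * (ε * h t ^ 2) := by gcongr
          _ = ε * M * h t ^ 2 * ε + ε * M * h t ^ 2 := by ring
          _ ≤ ε * M * h t ^ 2 * 1 + ε * M * h t ^ 2 := by gcongr
          _ = _ := by ring
      rw [abs_mul (D - _), abs_mul (4 : ℝ)]
      simp only [abs_mul (d * _), abs_mul d, abs_mul (G1 t), abs_mul ε, abs_mul (L1 t),
        abs_mul (L1 t ^ 2 - L2 t)]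
      rw [abs_of_nonneg hd0, abs_of_pos hε0, abs_of_pos b0, abs_of_pos (show (0 : ℝ) < 4 by norm_num)]
      calc _ ≤ d * (2 * h t ^ 2 * h t) * 1 + 4 * (d * (h t * h t) * (M * (ε * h t)))
            + D * (2 * (ε * M * h t ^ 2)) := by gcongr
        _ = 2 * (d * h t ^ 3) + 4 * (d * h t ^ 3) * (ε * M) + 2 * (D * ε * M) * h t ^ 2 := by ring
        _ ≤ 2 * (d * h t ^ 3) + 4 * (d * h t ^ 3) * (1 / 2) + 2 * (D * ε * M) * h t ^ 2 := by gcongr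
        _ ≤ d * h t := by rw [hDε]; linarith
  · rw [← mul_zero d]
    refine Tendsto.const_mul d ?_
    refine squeeze_zero' (Eventually.of_forall fun t => (hb t).1.le) ?_ tendsto_inv_atTop_zero
    filter_upwards [eventually_gt_atTop 0] with t ht
    obtain ⟨h0, -, this, -⟩ := hb t
    rw [abs_of_pos ht] at this
    rwa [le_inv_comm₀ h0 ht, ← one_div, le_div_iff₀ h0]
  · obtain ⟨x, hx, hgx⟩ := hg1 (ε * L X)
    obtain ⟨hT0, h1, h2⟩ := hT' X x hx
    refine ⟨T (x / ε), h1, ?_⟩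
    simp only [k, G]
    rw [h2, hgx]
    ring
  · obtain ⟨x, hx, hgx⟩ := hg0 (ε * L X)
    obtain ⟨hT0, h1, h2⟩ := hT' X x hx
    refine ⟨T (x / ε), h1, fun y hy => ?_⟩
    have h3 : g (ε * L y) = 0 := hgx _ ⟨by
      have := mul_le_mul_of_nonneg_left (hLmono hT0 (hT0.trans hy.1) hy.1) hε0.le
      linarith, mul_le_mul_of_nonneg_left (hLmono (hT0.trans hy.1) (hT0.trans (hy.1.trans hy.2)) hy.2) hε0.le⟩
    simp only [k, G]
    rw [h3]
    ring

lemma exists_primitive {p : ℝ → ℝ} (hp : ContDiff ℝ (⊤ : ℕ∞) p) : ∃ P : ℝ → ℝ,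
    ContDiff ℝ (⊤ : ℕ∞) P ∧ (∀ t, HasDerivAt P (p t) t) ∧ P 0 = 0 := by
  have h (t : ℝ) : HasDerivAt (fun t => ∫ x in (0 : ℝ)..t, p x) (p t) t :=
    intervalIntegral.integral_hasDerivAt_right (hp.continuous.intervalIntegrable _ _)
      (hp.continuous.stronglyMeasurableAtFilter _ _) hp.continuous.continuousAt
  refine ⟨_, contDiff_infty_iff_deriv.mpr ⟨fun t => (h t).differentiableAt, ?_⟩, h, by simp⟩
  rwa [show deriv (fun t => ∫ x in (0 : ℝ)..t, p x) = p from funext fun t => (h t).deriv]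

/-- In the logarithmic variable `t = -log r` the profile is `U`, with `U' = exp P`, `P' = p`, and
`r² f'(u(r))` becomes `c`, a Riccati expression in `p`. -/
lemma exists_phase (N C₁ C₂ : ℝ) (hN : 10 ≤ N) (hC₁ : 0 ≤ C₁) (hC₁₂ : C₁ ≤ C₂)
    (hC₂l : 2 * (N - 2) ≤ C₂) (hC₂u : C₂ ≤ (N - 2) ^ 2 / 4) :
    ∃ p c P U : ℝ → ℝ, ContDiff ℝ (⊤ : ℕ∞) p ∧ ContDiff ℝ (⊤ : ℕ∞) c ∧
      ContDiff ℝ (⊤ : ℕ∞) U ∧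
      (∀ t, c t = 2 * (N - 2) + (N - 4) * p t - p t ^ 2 - deriv p t) ∧
      (∀ t, HasDerivAt P (p t) t) ∧ P 0 = 0 ∧
      (∀ t, HasDerivAt U (Real.exp (P t)) t) ∧ U 0 = 0 ∧
      Tendsto U atTop atTop ∧
      (∀ t, p t ≤ (N - 4) / 2) ∧ (∀ t, C₁ ≤ c t ∧ c t ≤ C₂ ∧ 0 ≤ 2 * c t + deriv c t) ∧
      (∀ e > 0, ∃ᶠ t in atTop, c t ≤ C₁ + e) ∧ ∀ e > 0, ∃ᶠ t in atTop, C₂ - e ≤ c t := by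
  set D := C₂ - C₁ with hD
  set A := N ^ 2 / 4 - C₂ with hA
  have hA9 : 9 ≤ A := by rw [hA]; nlinarith
  have hD0 : 0 ≤ D := sub_nonneg.2 hC₁₂
  obtain ⟨k, η, hk, hb, hη, hk1, hk0⟩ := exists_slow D hD0
    fun t => (t + 1 + t * Real.exp (D / 6 * t)) ^ 2
  have hpos (t : ℝ) : 9 ≤ A + k t := by have := hb t; linarith
  let s : ℝ → ℝ := fun t => √(A + k t)
  have hs : ContDiff ℝ (⊤ : ℕ∞) s :=
    (contDiff_const.add hk).sqrt fun t => by have := hpos t; positivity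
  have hs2 (t : ℝ) : s t ^ 2 = A + k t := Real.sq_sqrt (by linarith [hpos t])
  have hs3 (t : ℝ) : 3 ≤ s t := Real.le_sqrt_of_sq_le (by linarith [hpos t])
  have hds (t : ℝ) : 2 * s t * deriv s t = deriv k t := by
    have h1 := (hasDerivAt_of_contDiff hs t).pow 2
    have h2 := (hasDerivAt_of_contDiff hk t).const_add A
    rw [show (s ^ 2) = fun t => A + k t from funext hs2] at h1
    simpa using h1.unique h2
  have hdds (t : ℝ) : 2 * deriv s t ^ 2 + 2 * s t * deriv (deriv s) t = deriv (deriv k) t := by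
    have h1 := ((hasDerivAt_of_contDiff hs t).const_mul 2).mul
      (hasDerivAt_of_contDiff (contDiff_deriv hs) t)
    rw [← show (fun t => 2 * s t * deriv s t) = deriv k from funext hds]
    have := h1.deriv
    change deriv (fun t => 2 * s t * deriv s t) t = _ at this
    linear_combination -this
  have hdsb (t : ℝ) : |deriv s t| ≤ η t / 6 := by
    have h1 := (hb t).2.2.2.2.2.1
    rw [← hds, abs_mul, abs_of_pos (by linarith [hs3 t])] at h1
    nlinarith [hs3 t, abs_nonneg (deriv s t)]
  have hddsb (t : ℝ) : |deriv (deriv s) t| ≤ η t / 2 := by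
    have h1 := (hb t).2.2.2.2.2.2
    have h2 : |2 * s t * deriv (deriv s) t| ≤ η t + 2 * (η t / 6) ^ 2 := by
      rw [show 2 * s t * deriv (deriv s) t = deriv (deriv k) t - 2 * deriv s t ^ 2 by
        linear_combination hdds t]
      refine (abs_sub _ _).trans ?_
      rw [abs_mul, abs_pow, abs_two]
      have := hdsb t
      gcongr
    rw [abs_mul, abs_of_pos (by linarith [hs3 t])] at h2
    nlinarith [hs3 t, abs_nonneg (deriv (deriv s) t), (hb t).1, (hb t).2.1]
  let p : ℝ → ℝ := fun t => (N - 4) / 2 - s t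
  have hp : ContDiff ℝ (⊤ : ℕ∞) p := contDiff_const.sub hs
  have hdp (t : ℝ) : deriv p t = -deriv s t := deriv_const_sub _
  let c : ℝ → ℝ := fun t => C₂ - k t + deriv s t
  have hc : ContDiff ℝ (⊤ : ℕ∞) c := (contDiff_const.sub hk).add (contDiff_deriv hs)
  have hdc (t : ℝ) : deriv c t = -deriv k t + deriv (deriv s) t :=
    (((hasDerivAt_of_contDiff hk t).const_sub C₂).add
      (hasDerivAt_of_contDiff (contDiff_deriv hs) t)).deriv
  obtain ⟨P, hPs, hP, hP0⟩ := exists_primitive hp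
  obtain ⟨U, hUs, hU, hU0⟩ := exists_primitive hPs.exp
  have hpl (t : ℝ) : -(k t / 6) ≤ p t := by
    have h1 : √A ≤ (N - 4) / 2 := Real.sqrt_le_iff.2 ⟨by linarith, by rw [hA]; nlinarith⟩
    have h2 : s t ≤ √A + k t / 6 := by
      have h3 : 3 ≤ √A := Real.le_sqrt_of_sq_le (by linarith)
      have h4 := Real.sq_sqrt (show 0 ≤ A by linarith)
      have h5 := hb t
      nlinarith [hs2 t, hs3 t]
    simp only [p]; linarith
  have hUmono : Monotone U := monotone_of_deriv_nonneg (fun t => (hU t).differentiableAt)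
    fun t => by rw [(hU t).deriv]; positivity
  refine ⟨p, c, P, U, hp, hc, hUs, fun t => ?_, hP, hP0, hU, hU0, ?_, fun t => ?_,
    fun t => ⟨?_, ?_, ?_⟩, fun e he => ?_, fun e he => ?_⟩
  · rw [hdp]
    simp only [c, p]
    linear_combination hs2 t
  · refine tendsto_atTop_atTop_of_monotone hUmono fun X => ?_
    obtain ⟨T, hT, hgap⟩ := hk0 (max X 1)
    have hT1 : 1 ≤ T := (le_max_right _ _).trans hT
    set w := T + 1 + T * Real.exp (D / 6 * T) with hw
    have hwT : T + 1 ≤ w := by rw [hw]; nlinarith [Real.exp_pos (D / 6 * T)]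
    have hTS : T ≤ w ^ 2 := by nlinarith
    refine ⟨w ^ 2, ((le_max_left _ _).trans hT).trans ?_⟩
    have hPT : -(D / 6 * T) ≤ P T := by
      have := sub_le_sub_of_hasDerivAt (zero_le_one.trans hT1)
        (fun t _ => ((hasDerivAt_id t).const_mul (-(D / 6)))) (fun t _ => hP t) fun t _ => by
          have := hb t
          have := hpl t
          linarith
      simp only [id, hP0] at this
      linarith
    have hPt (t : ℝ) (ht : t ∈ Icc T (w ^ 2)) :
        -(D / 6 * T) - 1 / 2 * Real.log (w ^ 2) ≤ P t := by
      have := sub_le_sub_of_hasDerivAt ht.1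
        (fun x hx => ((Real.hasDerivAt_log (by linarith [hx.1] : x ≠ 0)).const_mul (-(1 / 2))))
        (fun x _ => hP x) fun x hx => by
          have hx0 : 0 < x := by linarith [hx.1]
          have h1 := hpl x
          have h2 := (hb x).2.2.1
          rw [hgap x ⟨hx.1, hx.2.trans ht.2⟩] at h1
          rw [mul_comm, ← le_div_iff₀ hx0, one_div] at h2
          have : 0 < x⁻¹ := by positivity
          linarith
      have h1 := Real.log_nonneg hT1
      have h2 := Real.log_le_log (by linarith [ht.1]) ht.2
      linarith
    have hUS := sub_le_sub_of_hasDerivAt hTS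
      (fun t _ => ((hasDerivAt_id t).const_mul (Real.exp (-(D / 6 * T) - 1 / 2 * Real.log (w ^ 2)))))
      (fun t _ => hU t) fun t ht => by
        rw [mul_one]
        exact Real.exp_le_exp.2 (hPt t ht)
    have hUT : 0 ≤ U T := hU0 ▸ hUmono (zero_le_one.trans hT1)
    have hw0 : 0 < w := by linarith
    rw [Real.log_pow, Nat.cast_ofNat, ← mul_assoc, one_div, inv_mul_cancel₀ two_ne_zero, one_mul,
      Real.exp_sub, Real.exp_log hw0, Real.exp_neg] at hUS
    simp only [id] at hUS
    have hE := Real.exp_pos (D / 6 * T)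
    have : T ≤ (Real.exp (D / 6 * T))⁻¹ / w * (w ^ 2 - T) := by
      rw [inv_eq_one_div, div_div, div_mul_eq_mul_div, one_mul, le_div_iff₀ (by positivity)]
      nlinarith
    linarith
  · simp only [p]; linarith [hs3 t]
  · have h1 := hb t
    have h2 := abs_le.1 (hdsb t)
    simp only [c]; linarith
  · have h1 := hb t
    have h2 := abs_le.1 (hdsb t)
    simp only [c]; linarith
  · have h1 := hb t
    have h2 := abs_le.1 (hdsb t)
    have h3 := abs_le.1 (hddsb t)
    have h4 := abs_le.1 h1.2.2.2.2.2.1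
    rw [hdc]
    simp only [c]; linarith
  · have h1 : ∀ᶠ t in atTop, η t < e / 2 := hη.eventually_lt_const (by positivity)
    have h2 : ∃ᶠ t in atTop, k t = D - η t := frequently_atTop.2 hk1
    refine (h2.and_eventually h1).mono fun t ht => ?_
    have h2 := abs_le.1 (hdsb t)
    simp only [c]; linarith [ht.1, ht.2, (hb t).1]
  · have h1 : ∀ᶠ t in atTop, η t < e / 2 := hη.eventually_lt_const (by positivity)
    have h2 : ∃ᶠ t in atTop, k t = η t := frequently_atTop.2 fun X => by
      obtain ⟨T, hT, hgap⟩ := hk0 (max X 1)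
      have hT1 : 1 ≤ T := (le_max_right _ _).trans hT
      refine ⟨T, (le_max_left _ _).trans hT, hgap T ⟨le_rfl, ?_⟩⟩
      have := mul_pos (by linarith : 0 < T) (Real.exp_pos (D / 6 * T))
      nlinarith
    refine (h2.and_eventually h1).mono fun t ht => ?_
    have h2 := abs_le.1 (hdsb t)
    simp only [c]; linarith [ht.1, ht.2, (hb t).1]

/-- A smooth function with positive derivative has a monotone left inverse, smooth on the range. -/
lemma exists_smooth_inverse {U V : ℝ → ℝ} (hUs : ContDiff ℝ (⊤ : ℕ∞) U)
    (hU : ∀ t, HasDerivAt U (V t) t) (hV : ∀ t, 0 < V t) :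
    ∃ τ : ℝ → ℝ, (∀ t, τ (U t) = t) ∧ (∀ t, HasDerivAt τ (V t)⁻¹ (U t)) ∧
      ∀ t, ContDiffAt ℝ (⊤ : ℕ∞) τ (U t) := by
  have hmono : StrictMono U := strictMono_of_deriv_pos fun t => by rw [(hU t).deriv]; exact hV t
  have hstrict (t : ℝ) : HasStrictDerivAt U (V t) t :=
    hUs.contDiffAt.hasStrictDerivAt' (hU t) (by simp)
  have hopen : IsOpenMap U := isOpenMap_of_hasStrictDerivAt hstrict fun t => (hV t).ne'
  let e := (Topology.IsOpenEmbedding.of_continuous_injective_isOpenMap hUs.continuous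
    hmono.injective hopen).toOpenPartialHomeomorph U
  have hl (t : ℝ) : e.symm (U t) = t := e.left_inv (by simp [e])
  have ht (t : ℝ) : U t ∈ e.target := e.map_source (x := t) (by simp [e])
  refine ⟨e.symm, hl, fun t => ?_, fun t => ?_⟩
  · refine e.hasDerivAt_symm (ht t) (hV t).ne' ?_
    rw [hl]; exact hU t
  · refine e.contDiffAt_symm_deriv (hV t).ne' (ht t) ?_ ?_
    · rw [hl]; exact hU t
    · exact hUs.contDiffAt

theorem stmt14 (N : ℕ) (hN : 10 ≤ N) (C₁ C₂ : ℝ)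
    (hC₁ : 0 ≤ C₁) (hC₁₂ : C₁ ≤ C₂)
    (hC₂l : 2 * ((N:ℝ) - 2) ≤ C₂) (hC₂u : C₂ ≤ ((N:ℝ) - 2) ^ 2 / 4) :
    ∃ f u u' u'' : ℝ → ℝ,
      ContDiffOn ℝ (⊤ : ℕ∞) f (Set.Ici 0) ∧ StarCond f ∧
      ContDiffOn ℝ (⊤ : ℕ∞) u (Set.Ioc 0 1) ∧
      (∀ r ∈ Set.Ioc (0:ℝ) 1, HasDerivWithinAt u (u' r) (Set.Ioc 0 1) r) ∧
      (∀ r ∈ Set.Ioc (0:ℝ) 1, HasDerivWithinAt u' (u'' r) (Set.Ioc 0 1) r) ∧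
      u 1 = 0 ∧
      (∀ r ∈ Set.Ioc (0:ℝ) 1, u' r < 0) ∧
      Tendsto u (nhdsWithin 0 (Set.Ioi 0)) atTop ∧
      IntervalIntegrable (fun r => r ^ (N - 1) * (u r ^ 2 + u' r ^ 2)) volume 0 1 ∧
      (∀ r ∈ Set.Ioc (0:ℝ) 1, -u'' r - ((N:ℝ) - 1) / r * u' r = f (u r)) ∧
      (∀ r ∈ Set.Ioc (0:ℝ) 1,
        derivWithin f (Set.Ici 0) (u r) ≤ ((N:ℝ) - 2) ^ 2 / (4 * r ^ 2)) ∧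
      Filter.liminf (fun r => r ^ 2 * derivWithin f (Set.Ici 0) (u r))
        (nhdsWithin 0 (Set.Ioi 0)) = C₁ ∧
      Filter.limsup (fun r => r ^ 2 * derivWithin f (Set.Ici 0) (u r))
        (nhdsWithin 0 (Set.Ioi 0)) = C₂ := by
  have hN' : (10 : ℝ) ≤ N := by exact_mod_cast hN
  obtain ⟨p, c, P, U, hp, hc, hUs, hcp, hP, hP0, hU, hU0, hUtop, hple, hcb, hc1, hc2⟩ :=
    exists_phase N C₁ C₂ hN' hC₁ hC₁₂ hC₂l hC₂u
  have hPs : ContDiff ℝ (⊤ : ℕ∞) P :=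
    contDiff_infty_iff_deriv.mpr ⟨fun t => (hP t).differentiableAt,
      by rwa [show deriv P = p from funext fun t => (hP t).deriv]⟩
  let V : ℝ → ℝ := fun t => Real.exp (P t)
  have hV0 (t : ℝ) : 0 < V t := Real.exp_pos _
  have hVd (t : ℝ) : HasDerivAt V (V t * p t) t := (hP t).exp
  have hUmono : StrictMono U :=
    strictMono_of_deriv_pos fun t => by rw [(hU t).deriv]; exact hV0 t
  obtain ⟨τ, hτU, hτd, hτs⟩ := exists_smooth_inverse hUs hU hV0
  have hsurj (x : ℝ) (hx : 0 ≤ x) : ∃ t, 0 ≤ t ∧ U t = x := by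
    obtain ⟨T, hT0, hT⟩ := ((eventually_ge_atTop 0).and (hUtop.eventually_ge_atTop x)).exists
    obtain ⟨t, ht, htx⟩ := intermediate_value_Icc hT0 hUs.continuous.continuousOn
      (⟨hU0.symm ▸ hx, hT⟩ : x ∈ Icc (U 0) (U T))
    exact ⟨t, ht.1, htx⟩
  let F : ℝ → ℝ := fun t => Real.exp (2 * t) * (V t * ((N : ℝ) - 2 - p t))
  let W : ℝ → ℝ := fun t => Real.exp (2 * t) * c t
  have hexp (t : ℝ) : HasDerivAt (fun t => Real.exp (2 * t)) (2 * Real.exp (2 * t)) t := by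
    simpa [mul_comm] using ((hasDerivAt_id t).const_mul 2).exp
  have hFd (t : ℝ) : HasDerivAt F (W t * V t) t := by
    refine HasDerivAt.congr_deriv (f := F) ((hexp t).mul ((hVd t).mul
      ((hasDerivAt_of_contDiff hp t).const_sub ((N : ℝ) - 2)))) ?_
    simp only [W, hcp]
    ring
  have hW0 (t : ℝ) : 0 ≤ W t := mul_nonneg (Real.exp_pos _).le (hC₁.trans (hcb t).1)
  have hFmono : Monotone F := monotone_of_deriv_nonneg (fun t => (hFd t).differentiableAt)
    fun t => by rw [(hFd t).deriv]; exact mul_nonneg (hW0 t) (hV0 t).le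
  have hWd (t : ℝ) : HasDerivAt W (Real.exp (2 * t) * (2 * c t + deriv c t)) t := by
    refine HasDerivAt.congr_deriv (f := W) ((hexp t).mul (hasDerivAt_of_contDiff hc t)) ?_
    ring
  have hWmono : Monotone W := monotone_of_deriv_nonneg (fun t => (hWd t).differentiableAt)
    fun t => by rw [(hWd t).deriv]; exact mul_nonneg (Real.exp_pos _).le (hcb t).2.2
  have hWtop (X : ℝ) : ∃ t, 0 ≤ t ∧ X ≤ W t := by
    have h1 : ∃ᶠ t in atTop, C₂ - 15 ≤ c t := hc2 15 (by norm_num)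
    obtain ⟨t, ht, ht'⟩ := (h1.and_eventually (eventually_ge_atTop (max X 0))).exists
    have ht0 : 0 ≤ t := (le_max_right _ _).trans ht'
    refine ⟨t, ht0, ?_⟩
    have h2 := Real.add_one_le_exp (2 * t)
    have h3 : X ≤ t := (le_max_left _ _).trans ht'
    have h4 : 1 ≤ c t := by linarith
    simp only [W]
    nlinarith
  let f : ℝ → ℝ := fun x => F (τ x)
  have hfU (t : ℝ) : f (U t) = F t := by simp only [f, hτU]
  have hfd (t : ℝ) : HasDerivAt f (W t) (U t) := by
    have h1 : HasDerivAt F (W t * V t) (τ (U t)) := by rw [hτU]; exact hFd t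
    refine HasDerivAt.congr_deriv (f := f) (h1.comp (U t) (hτd t)) ?_
    rw [mul_assoc, mul_inv_cancel₀ (hV0 t).ne', mul_one]
  have hFs : ContDiff ℝ (⊤ : ℕ∞) F := (contDiff_const.mul contDiff_id).exp.mul
    (hPs.exp.mul (contDiff_const.sub hp))
  have hfs : ContDiffOn ℝ (⊤ : ℕ∞) f (Ici 0) := fun x hx => by
    obtain ⟨t, -, rfl⟩ := hsurj x hx
    exact (hFs.contDiffAt.comp _ (hτs t)).contDiffWithinAt
  have hdw (t : ℝ) (ht : 0 ≤ t) : derivWithin f (Ici 0) (U t) = W t :=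
    (hfd t).hasDerivWithinAt.derivWithin
      (uniqueDiffOn_Ici 0 _ (hU0 ▸ hUmono.monotone ht : 0 ≤ U t))
  have hU_nonneg {t : ℝ} (ht : 0 ≤ t) : 0 ≤ U t := hU0 ▸ hUmono.monotone ht
  have hlog {r : ℝ} (hr : r ∈ Ioc (0 : ℝ) 1) : 0 ≤ -Real.log r :=
    neg_nonneg.2 (Real.log_nonpos hr.1.le hr.2)
  have hsuper : Tendsto (fun t => f t / t) atTop atTop := by
    refine tendsto_atTop.2 fun X => ?_
    obtain ⟨t₀, ht₀, hX⟩ := hWtop (X + 1)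
    filter_upwards [eventually_ge_atTop (U t₀), eventually_gt_atTop 0,
      eventually_ge_atTop ((X + 1) * U t₀ - F t₀)] with x hx hx0 hx1
    obtain ⟨t, ht, rfl⟩ := hsurj x hx0.le
    rw [le_div_iff₀ hx0, hfU]
    have := sub_le_sub_of_hasDerivAt (hUmono.le_iff_le.1 hx)
      (fun t _ => (hU t).const_mul (X + 1)) (fun t _ => hFd t) fun y hy =>
        mul_le_mul_of_nonneg_right (hX.trans (hWmono hy.1)) (hV0 y).le
    linarith
  have hstar : StarCond f := by
    refine ⟨hfs.of_le (by exact_mod_cast le_top), fun x hx y hy hxy => ?_, ?_, ?_, hsuper⟩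
    · obtain ⟨s, -, rfl⟩ := hsurj x hx
      obtain ⟨t, -, rfl⟩ := hsurj y hy
      rw [hfU, hfU]
      exact hFmono (hUmono.le_iff_le.1 hxy)
    · refine MonotoneOn.convexOn_of_deriv (convex_Ici 0) hfs.continuousOn
        ((hfs.differentiableOn (by simp)).mono interior_subset) fun x hx y hy hxy => ?_
      obtain ⟨s, -, rfl⟩ := hsurj x (interior_subset hx)
      obtain ⟨t, -, rfl⟩ := hsurj y (interior_subset hy)
      rw [(hfd s).deriv, (hfd t).deriv]
      exact hWmono (hUmono.le_iff_le.1 hxy)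
    · have h1 : f 0 = F 0 := by rw [← hfU, hU0]
      have h2 := hple 0
      rw [h1]
      exact mul_pos (Real.exp_pos _) (mul_pos (hV0 0) (by linarith))
  let u : ℝ → ℝ := fun r => U (-Real.log r)
  let u₁ : ℝ → ℝ := fun r => -(V (-Real.log r) * r⁻¹)
  let u₂ : ℝ → ℝ := fun r => V (-Real.log r) * (p (-Real.log r) + 1) * (r⁻¹) ^ 2
  have hlogd {r : ℝ} (hr : 0 < r) : HasDerivAt (fun r => -Real.log r) (-r⁻¹) r :=
    (Real.hasDerivAt_log hr.ne').neg
  have hu {r : ℝ} (hr : 0 < r) : HasDerivAt u (u₁ r) r :=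
    HasDerivAt.congr_deriv (f := u) ((hU _).comp r (hlogd hr)) (by simp only [u₁, V]; ring)
  have hu₁ {r : ℝ} (hr : 0 < r) : HasDerivAt u₁ (u₂ r) r := by
    refine HasDerivAt.congr_deriv (f := u₁)
      ((((hVd _).comp r (hlogd hr)).mul (hasDerivAt_inv hr.ne')).neg) ?_
    simp only [u₂, Function.comp]
    field_simp
    ring
  have htop : Tendsto (fun r => -Real.log r) (𝓝[>] 0) atTop :=
    tendsto_neg_atBot_atTop.comp Real.tendsto_log_nhdsGT_zero
  have hbot : Tendsto (fun t => Real.exp (-t)) atTop (𝓝[>] 0) :=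
    tendsto_nhdsWithin_iff.2 ⟨Real.tendsto_exp_neg_atTop_nhds_zero,
      Eventually.of_forall fun t => Real.exp_pos _⟩
  have hexplog {r : ℝ} (hr : 0 < r) : Real.exp (2 * -Real.log r) = (r ^ 2)⁻¹ := by
    rw [mul_neg, Real.exp_neg, two_mul, Real.exp_add, Real.exp_log hr, sq]
  have hrc {r : ℝ} (hr : r ∈ Ioc (0 : ℝ) 1) :
      r ^ 2 * derivWithin f (Ici 0) (u r) = c (-Real.log r) := by
    have := pow_pos hr.1 2
    simp only [u]
    rw [hdw _ (hlog hr)]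
    simp only [W]
    rw [hexplog hr.1, mul_inv_cancel_left₀ this.ne']
  have hnear : ∀ᶠ r in 𝓝[>] (0 : ℝ), r ∈ Ioc (0 : ℝ) 1 := Ioc_mem_nhdsGT one_pos
  have hlo : ∀ᶠ r in 𝓝[>] (0 : ℝ), C₁ ≤ r ^ 2 * derivWithin f (Ici 0) (u r) := by
    filter_upwards [hnear] with r hr
    rw [hrc hr]; exact (hcb _).1
  have hhi : ∀ᶠ r in 𝓝[>] (0 : ℝ), r ^ 2 * derivWithin f (Ici 0) (u r) ≤ C₂ := by
    filter_upwards [hnear] with r hr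
    rw [hrc hr]; exact (hcb _).2.1
  have hfreq {q : ℝ → Prop} (h : ∃ᶠ t in atTop, q (c t)) :
      ∃ᶠ r in 𝓝[>] (0 : ℝ), q (r ^ 2 * derivWithin f (Ici 0) (u r)) := by
    have : ∃ᶠ r in 𝓝[>] (0 : ℝ), q (c (-Real.log r)) := by
      refine hbot.frequently ?_
      simpa only [Real.log_exp, neg_neg] using h
    refine (this.and_eventually hnear).mono fun r hr => ?_
    rw [hrc hr.2]; exact hr.1
  have hbdd_lo := isBoundedUnder_of_eventually_ge hlo
  have hbdd_hi := isBoundedUnder_of_eventually_le hhi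
  refine ⟨f, u, u₁, u₂, hfs, hstar, fun r hr => ?_, fun r hr => (hu hr.1).hasDerivWithinAt,
    fun r hr => (hu₁ hr.1).hasDerivWithinAt, by simp [u, hU0], fun r hr => ?_, hUtop.comp htop,
    ?_, fun r hr => ?_, fun r hr => ?_, ?_, ?_⟩
  · exact (hUs.contDiffAt.comp r (Real.contDiffAt_log.2 hr.1.ne').neg).contDiffWithinAt
  · exact neg_neg_of_pos (mul_pos (hV0 _) (inv_pos.2 hr.1))
  · rw [intervalIntegrable_iff_integrableOn_Ioc_of_le zero_le_one]
    have hcu : ContinuousOn u (Ioc 0 1) :=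
      fun r hr => (hu hr.1).continuousAt.continuousWithinAt
    have hcu₁ : ContinuousOn u₁ (Ioc 0 1) :=
      fun r hr => (hu₁ hr.1).continuousAt.continuousWithinAt
    have hcont : ContinuousOn (fun r => r ^ (N - 1) * (u r ^ 2 + u₁ r ^ 2)) (Ioc 0 1) :=
      (continuousOn_id.pow _).mul ((hcu.pow 2).add (hcu₁.pow 2))
    refine IntegrableOn.of_bound (by simp) (hcont.aestronglyMeasurable measurableSet_Ioc) 2 ?_
    filter_upwards [ae_restrict_mem measurableSet_Ioc] with r hr
    set m : ℝ := ((N : ℝ) - 4) / 2 with hm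
    have hm1 : 1 ≤ m := by linarith
    have hPle (t : ℝ) (ht : 0 ≤ t) : P t ≤ m * t := by
      have := sub_le_sub_of_hasDerivAt ht (fun t _ => hP t)
        (fun t _ => (hasDerivAt_id t).const_mul m) fun t _ => by
          rw [mul_one]; exact hple t
      simp only [hP0, id] at this
      linarith
    have hmd (t : ℝ) : HasDerivAt (fun t => Real.exp (m * t)) (m * Real.exp (m * t)) t := by
      simpa [mul_comm] using ((hasDerivAt_id t).const_mul m).exp
    have hUle (t : ℝ) (ht : 0 ≤ t) : U t ≤ Real.exp (m * t) := by
      have := sub_le_sub_of_hasDerivAt ht (fun t _ => hU t) (fun t _ => hmd t) fun t ht => by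
          have := Real.exp_le_exp.2 (hPle t ht.1)
          nlinarith [Real.exp_pos (m * t)]
      simp only [hU0, mul_zero, Real.exp_zero] at this
      linarith
    have hr0 := hr.1
    have ht := hlog hr
    have hsq : Real.exp (m * -Real.log r) ^ 2 = (r ^ (N - 4))⁻¹ := by
      rw [← Real.exp_nat_mul, ← Real.exp_log (pow_pos hr0 (N - 4)), ← Real.exp_neg,
        Real.log_pow, Nat.cast_sub (by omega), hm]
      congr 1; push_cast; ring
    have h1 : u r ^ 2 ≤ (r ^ (N - 4))⁻¹ := by
      rw [← hsq]
      have := hU_nonneg ht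
      have := hUle _ ht
      simp only [u]
      gcongr
    have h2 : u₁ r ^ 2 ≤ (r ^ (N - 4))⁻¹ * (r ^ 2)⁻¹ := by
      rw [← hsq]
      simp only [u₁]
      rw [neg_sq, mul_pow, inv_pow]
      have := (hV0 (-Real.log r)).le
      have : V (-Real.log r) ≤ Real.exp (m * -Real.log r) := Real.exp_le_exp.2 (hPle _ ht)
      gcongr
    have hN4 : r ^ (N - 1) = r ^ (N - 4) * r ^ 3 := by rw [← pow_add]; congr 1; omega
    rw [Real.norm_of_nonneg (by positivity), hN4]
    calc r ^ (N - 4) * r ^ 3 * (u r ^ 2 + u₁ r ^ 2)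
        ≤ r ^ (N - 4) * r ^ 3 * ((r ^ (N - 4))⁻¹ + (r ^ (N - 4))⁻¹ * (r ^ 2)⁻¹) := by gcongr
      _ = r ^ 3 + r := by field_simp
      _ ≤ 2 := by
        have := pow_le_one₀ (n := 3) hr0.le hr.2
        linarith [hr.2]
  · simp only [u]
    rw [hfU]
    simp only [u₁, u₂, F]
    rw [hexplog hr.1]
    have := hr.1.ne'
    field_simp
    ring
  · have hr2 := pow_pos hr.1 2
    rw [le_div_iff₀ (by positivity)]
    have := hrc hr
    have := (hcb (-Real.log r)).2.1
    linarith
  · refine le_antisymm (le_of_forall_pos_le_add fun e he => ?_) ?_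
    · exact liminf_le_of_frequently_le (hfreq (q := fun x => x ≤ C₁ + e) (hc1 e he)) hbdd_lo
    · exact le_liminf_of_le hbdd_hi.isCoboundedUnder_ge hlo
  · refine le_antisymm ?_ (le_of_forall_pos_sub_le fun e he => ?_)
    · exact limsup_le_of_le hbdd_lo.isCoboundedUnder_le hhi
    · exact le_limsup_of_frequently_le (hfreq (q := fun x => C₂ - e ≤ x) (hc2 e he)) hbdd_hi
end
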